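/- Let Ω be a rational convex domain, k ∈ ℤ≥0, and let F be the family of nonempty (possibly degenerate) compact convex polygons Ξ ⊆ ℝ², each of whose edges is parallel to an edge of Ω, with #(Ξ ∩ ℤ²) ≥ k+1. Then the infimum inf{ℓ_Ω(∂Ξ) : Ξ ∈ F} is attained; moreover it is attained by some Ξ ∈ F that has a lattice point on every edge, and hence by a polygon all of whose vertices are rational. -/

import Mathlib

open scoped BigOperators Pointwise

noncomputable section

/-- Planar cross product `det(v,p) = v₁p₂ − v₂p₁`. -/
def det2 (v p : ℝ × ℝ) : ℝ := v.1 * p.2 - v.2 * p.1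

/-- The `Ω`-length of a vector `v`: `max_{p ∈ Ω} det(v,p)`. -/
def omegaLen (Ω : Set (ℝ × ℝ)) (v : ℝ × ℝ) : ℝ := sSup (det2 v '' Ω)

/-- A (possibly degenerate) compact convex polygon with vertices listed in
clockwise order: a cyclic (period `n`) list of pairwise distinct vertices such
that the polygon (the convex hull of the vertices) lies in the right
half-plane of every directed edge. -/
structure ClockPolygon where
  n : ℕ
  npos : 0 < n
  verts : ℕ → ℝ × ℝ
  periodic : ∀ i, verts (i + n) = verts i
  inj : ∀ i j, i < n → j < n → verts i = verts j → i = j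
  clockwise : ∀ i, ∀ q ∈ convexHull ℝ (Set.range verts),
      det2 (verts (i + 1) - verts i) (q - verts i) ≤ 0

/-- The underlying point set of a polygon. -/
def ClockPolygon.body (P : ClockPolygon) : Set (ℝ × ℝ) :=
  convexHull ℝ (Set.range P.verts)

/-- The `Ω`-perimeter `ℓ_Ω(∂Λ)`: the sum of the `Ω`-lengths of the edge
vectors of `Λ`. -/
def omegaPerim (Ω : Set (ℝ × ℝ)) (P : ClockPolygon) : ℝ :=
  ∑ i ∈ Finset.range P.n, omegaLen Ω (P.verts (i + 1) - P.verts i)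

/-- Lattice points of the plane. -/
def IsLatticePt (p : ℝ × ℝ) : Prop := (∃ m : ℤ, p.1 = m) ∧ (∃ m : ℤ, p.2 = m)

/-- Rational points of the plane. -/
def IsRationalPt (p : ℝ × ℝ) : Prop := (∃ q : ℚ, p.1 = q) ∧ (∃ q : ℚ, p.2 = q)

/-- The number of lattice points in a set. -/
def latticeCount (S : Set (ℝ × ℝ)) : ℕ := {p ∈ S | IsLatticePt p}.ncard

/-- Competitor convex lattice domains: convex hulls of finite nonempty sets of
lattice points in `ℝ≥0²`, containing the origin and closed under taking
coordinate rectangles. -/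
def IsCompetitor (P : ClockPolygon) : Prop :=
  (∀ i, IsLatticePt (P.verts i)) ∧
  (∀ i, 0 ≤ (P.verts i).1 ∧ 0 ≤ (P.verts i).2) ∧
  (((0 : ℝ), (0 : ℝ)) ∈ P.body) ∧
  ∀ q ∈ P.body, Set.Icc (0 : ℝ) q.1 ×ˢ Set.Icc (0 : ℝ) q.2 ⊆ P.body

/-- ECH capacities of `X_Ω`, via Cristofaro-Gardiner's combinatorial formula
(taken as a definition). -/
def echCap (Ω : Set (ℝ × ℝ)) (k : ℕ) : ℝ :=
  sInf { r | ∃ P : ClockPolygon, IsCompetitor P ∧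
      latticeCount P.body = k + 1 ∧ omegaPerim Ω P = r }

/-- The cap function `cap_{X_Ω}(r) = #{k : c_k(X_Ω) ≤ r}`. -/
def capFn (Ω : Set (ℝ × ℝ)) (r : ℝ) : ℕ := {k : ℕ | echCap Ω k ≤ r}.ncard

/-- A convex domain: a convex polygon in `ℝ≥0²` with nonempty interior,
containing the origin and closed under taking coordinate rectangles. -/
structure ConvexDomain where
  P : ClockPolygon
  int_nonempty : (interior P.body).Nonempty
  nonneg : ∀ q ∈ P.body, 0 ≤ q.1 ∧ 0 ≤ q.2
  zero_mem : (((0 : ℝ), (0 : ℝ)) ∈ P.body)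
  rect : ∀ q ∈ P.body, Set.Icc (0 : ℝ) q.1 ×ˢ Set.Icc (0 : ℝ) q.2 ⊆ P.body

def ConvexDomain.body (Ω : ConvexDomain) : Set (ℝ × ℝ) := Ω.P.body

/-- A convex lattice domain: all vertices are lattice points. -/
def ConvexDomain.IsLattice (Ω : ConvexDomain) : Prop :=
  ∀ i, IsLatticePt (Ω.P.verts i)

/-- A rational convex domain: all vertices are rational points. -/
def ConvexDomain.IsRational (Ω : ConvexDomain) : Prop :=
  ∀ i, IsRationalPt (Ω.P.verts i)

/-- `X_Ω` is tightly constrained with lower bound `r₀` if every integer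
`r ≥ r₀` is a value `c_k(X_Ω)`. -/
def TightlyConstrained (Ω : ConvexDomain) (r₀ : ℕ) : Prop :=
  ∀ r : ℕ, r₀ ≤ r → ∃ k : ℕ, echCap Ω.body k = r

/-- Every (nonzero) edge of `Q` is parallel to an edge of `P`. -/
def EdgesParallel (Q P : ClockPolygon) : Prop :=
  ∀ i < Q.n, Q.verts (i + 1) - Q.verts i ≠ 0 →
    ∃ j < P.n, ∃ t : ℝ, t ≠ 0 ∧
      Q.verts (i + 1) - Q.verts i = t • (P.verts (j + 1) - P.verts j)

/-- Euclidean inner product on the plane. -/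
def dot2 (u p : ℝ × ℝ) : ℝ := u.1 * p.1 + u.2 * p.2

/-- The dual-norm value `max_{p ∈ K} u·p` (the support function of `K`). -/
def dualLen (K : Set (ℝ × ℝ)) (u : ℝ × ℝ) : ℝ := sSup (dot2 u '' K)

/-- The pseudonorm length `ℓ'_Ω(∂Λ)` with respect to a translated body `K`. -/
def dualPerim (K : Set (ℝ × ℝ)) (P : ClockPolygon) : ℝ :=
  ∑ i ∈ Finset.range P.n, dualLen K (P.verts (i + 1) - P.verts i)


lemma det2_sub_right (u p q : ℝ × ℝ) : det2 u (p - q) = det2 u p - det2 u q := by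
  simp only [det2, Prod.fst_sub, Prod.snd_sub]; ring
lemma det2_smul_left (c : ℝ) (u p : ℝ × ℝ) : det2 (c • u) p = c * det2 u p := by
  simp only [det2, Prod.smul_fst, Prod.smul_snd, smul_eq_mul]; ring
lemma det2_smul_right (c : ℝ) (u p : ℝ × ℝ) : det2 u (c • p) = c * det2 u p := by
  simp only [det2, Prod.smul_fst, Prod.smul_snd, smul_eq_mul]; ring
lemma det2_add_right (u p q : ℝ × ℝ) : det2 u (p + q) = det2 u p + det2 u q := by
  simp only [det2, Prod.fst_add, Prod.snd_add]; ring
lemma det2_self (u : ℝ × ℝ) : det2 u u = 0 := by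
  simp only [det2]; ring

lemma exists_smul_of_det2_eq_zero {d w : ℝ × ℝ} (hd : d ≠ 0) (h : det2 d w = 0) :
    ∃ r : ℝ, w = r • d := by
  obtain ⟨a, b⟩ := d
  obtain ⟨x, y⟩ := w
  simp only [det2] at h
  by_cases ha : a = 0
  · have hb : b ≠ 0 := by
      rintro rfl; exact hd (by simp [ha])
    refine ⟨y / b, ?_⟩
    subst ha
    have hx : x = 0 := by
      have : b * x = 0 := by linarith
      exact (mul_eq_zero.1 this).resolve_left hb
    ext <;> simp [hx, hb]
  · refine ⟨x / a, ?_⟩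
    ext
    · simp [ha]
    · simp only [Prod.smul_mk, smul_eq_mul]; field_simp; linarith

namespace ClockPolygon

lemma vert_mem (Q : ClockPolygon) (i : ℕ) : Q.verts i ∈ Q.body :=
  subset_convexHull ℝ _ ⟨i, rfl⟩

lemma cw (Q : ClockPolygon) (i : ℕ) {q : ℝ × ℝ} (hq : q ∈ Q.body) :
    det2 (Q.verts (i + 1) - Q.verts i) (q - Q.verts i) ≤ 0 := Q.clockwise i q hq

lemma cw' (Q : ClockPolygon) (i : ℕ) {q : ℝ × ℝ} (hq : q ∈ Q.body) :
    det2 (Q.verts (i + 1) - Q.verts i) (q - Q.verts (i + 1)) ≤ 0 := by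
  have := Q.cw i hq
  have e : det2 (Q.verts (i + 1) - Q.verts i) (q - Q.verts (i + 1)) =
    det2 (Q.verts (i + 1) - Q.verts i) (q - Q.verts i) := by
    simp only [det2, Prod.fst_sub, Prod.snd_sub]; ring
  rw [e]; exact this

lemma verts_add_mul (Q : ClockPolygon) (i k : ℕ) : Q.verts (i + k * Q.n) = Q.verts i := by
  induction k with
  | zero => simp
  | succ k ih => rw [Nat.succ_mul, ← add_assoc, Q.periodic, ih]

lemma verts_mod (Q : ClockPolygon) (i : ℕ) : Q.verts (i % Q.n) = Q.verts i := by
  conv_rhs => rw [← Nat.mod_add_div i Q.n, mul_comm, Q.verts_add_mul]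

lemma verts_eq_iff (Q : ClockPolygon) (i j : ℕ) :
    Q.verts i = Q.verts j ↔ i % Q.n = j % Q.n := by
  constructor
  · intro h
    rw [← Q.verts_mod i, ← Q.verts_mod j] at h
    exact Q.inj _ _ (Nat.mod_lt _ Q.npos) (Nat.mod_lt _ Q.npos) h
  · intro h
    rw [← Q.verts_mod i, h, Q.verts_mod]

lemma range_rot (Q : ClockPolygon) (s : ℕ) :
    Set.range (fun i => Q.verts (i + s)) = Set.range Q.verts := by
  apply Set.Subset.antisymm
  · rintro _ ⟨i, rfl⟩; exact ⟨_, rfl⟩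
  · rintro _ ⟨i, rfl⟩
    refine ⟨i + s * Q.n - s, ?_⟩
    have : s ≤ s * Q.n := Nat.le_mul_of_pos_right _ Q.npos
    simp only
    rw [Nat.sub_add_cancel (by omega), Q.verts_add_mul]

/-- Rotation of the indexing. -/
def rot (Q : ClockPolygon) (s : ℕ) : ClockPolygon where
  n := Q.n
  npos := Q.npos
  verts i := Q.verts (i + s)
  periodic i := by
    have : i + Q.n + s = i + s + Q.n := by ring
    rw [this, Q.periodic]
  inj i j hi hj h := by
    rw [Q.verts_eq_iff] at h
    have h2 : i ≡ j [MOD Q.n] := Nat.ModEq.add_right_cancel' s h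
    have h3 : i % Q.n = j % Q.n := h2
    rwa [Nat.mod_eq_of_lt hi, Nat.mod_eq_of_lt hj] at h3
  clockwise i q hq := by
    rw [Q.range_rot s] at hq
    have := Q.clockwise (i + s) q hq
    have e : i + 1 + s = i + s + 1 := by ring
    rw [e]; exact this

@[simp] lemma rot_n (Q : ClockPolygon) (s : ℕ) : (Q.rot s).n = Q.n := rfl
lemma rot_verts (Q : ClockPolygon) (s i : ℕ) : (Q.rot s).verts i = Q.verts (i + s) := rfl
lemma rot_body (Q : ClockPolygon) (s : ℕ) : (Q.rot s).body = Q.body := by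
  unfold body; exact congrArg _ (Q.range_rot s)

lemma rot_sum {M : Type} [AddCommMonoid M] (Q : ClockPolygon) (s : ℕ)
    (g : ℝ × ℝ → ℝ × ℝ → M) :
    ∑ i ∈ Finset.range (Q.rot s).n, g ((Q.rot s).verts i) ((Q.rot s).verts (i + 1)) =
    ∑ i ∈ Finset.range Q.n, g (Q.verts i) (Q.verts (i + 1)) := by
  simp only [rot_n, rot_verts]
  induction s with
  | zero => rfl
  | succ s ih =>
    rw [← ih]
    obtain ⟨m, hm⟩ : ∃ m, Q.n = m + 1 := ⟨Q.n - 1, by have := Q.npos; omega⟩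
    rw [hm, Finset.sum_range_succ, Finset.sum_range_succ']
    congr 1
    · apply Finset.sum_congr rfl
      intro i _
      congr 2 <;> ring_nf
    · have e1 : m + (s + 1) = s + Q.n := by omega
      have e2 : m + 1 + (s + 1) = s + 1 + Q.n := by omega
      rw [e1, e2, Q.periodic, Q.periodic]
      congr 2 <;> ring_nf

lemma range_eq_image (Q : ClockPolygon) : Set.range Q.verts = Q.verts '' Set.Iio Q.n := by
  apply Set.Subset.antisymm
  · rintro _ ⟨i, rfl⟩
    exact ⟨i % Q.n, Nat.mod_lt _ Q.npos, Q.verts_mod i⟩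
  · rintro _ ⟨i, _, rfl⟩; exact ⟨i, rfl⟩

lemma body_compact (Q : ClockPolygon) : IsCompact Q.body := by
  unfold body
  rw [range_eq_image]
  exact ((Set.finite_Iio _).image _).isCompact_convexHull ℝ

lemma body_convex (Q : ClockPolygon) : Convex ℝ Q.body := convex_convexHull ℝ _

lemma edge_ne (Q : ClockPolygon) (h : 2 ≤ Q.n) (i : ℕ) : Q.verts (i + 1) ≠ Q.verts i := by
  intro e
  rw [Q.verts_eq_iff] at e
  have h1 : (1 + i) ≡ (0 + i) [MOD Q.n] := by
    rw [add_comm 1 i, zero_add]; exact e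
  have h2 : 1 % Q.n = 0 % Q.n := Nat.ModEq.add_right_cancel' i h1
  rw [Nat.mod_eq_of_lt (by omega), Nat.zero_mod] at h2
  omega

end ClockPolygon

/-- Building a polygon from a finite sequence. -/
lemma exists_ofSeq (m : ℕ) (x : ℕ → ℝ × ℝ)
    (hinj : ∀ i j, i ≤ m → j ≤ m → x i = x j → i = j)
    (h1 : ∀ i < m, ∀ j ≤ m, det2 (x (i + 1) - x i) (x j - x i) ≤ 0)
    (h2 : ∀ j ≤ m, det2 (x 0 - x m) (x j - x m) ≤ 0) :
    ∃ Q : ClockPolygon, Q.n = m + 1 ∧ (∀ i ≤ m, Q.verts i = x i) ∧ Q.verts (m + 1) = x 0 := by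
  refine ⟨⟨m + 1, Nat.succ_pos _, fun k => x (k % (m + 1)), ?_, ?_, ?_⟩, rfl, ?_, ?_⟩
  · intro i; simp
  · intro i j hi hj h
    simp only [Nat.mod_eq_of_lt hi, Nat.mod_eq_of_lt hj] at h
    exact hinj i j (by omega) (by omega) h
  · intro i q hq
    have hlin : Convex ℝ {q : ℝ × ℝ | det2 (x ((i + 1) % (m + 1)) - x (i % (m + 1)))
        (q - x (i % (m + 1))) ≤ 0} := by
      intro a ha b hb s t hs ht hst
      simp only [Set.mem_ofPred_eq] at *
      have e : s • a + t • b - x (i % (m + 1)) =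
          s • (a - x (i % (m + 1))) + t • (b - x (i % (m + 1))) := by
        have : x (i % (m + 1)) = (s + t) • x (i % (m + 1)) := by rw [hst, one_smul]
        conv_lhs => rw [this]
        module
      rw [e, det2_add_right, det2_smul_right, det2_smul_right]
      nlinarith
    refine convexHull_min ?_ hlin hq
    rintro _ ⟨j, rfl⟩
    simp only [Set.mem_ofPred_eq]
    have hi : i % (m + 1) < m + 1 := Nat.mod_lt i (Nat.succ_pos m)
    have hj : j % (m + 1) < m + 1 := Nat.mod_lt j (Nat.succ_pos m)
    rcases Nat.lt_or_ge (i % (m + 1)) m with hlt | hge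
    · have e : (i + 1) % (m + 1) = i % (m + 1) + 1 := by
        rw [Nat.add_mod, Nat.mod_eq_of_lt (a := i % (m + 1) + 1 % (m + 1))]
        · rcases m with _ | m
          · omega
          · simp
        · rcases m with _ | m
          · omega
          · simp; omega
      rw [e]
      exact h1 _ hlt _ (by omega)
    · have e0 : i % (m + 1) = m := by omega
      have e : (i + 1) % (m + 1) = 0 := by
        rw [Nat.add_mod, e0]
        rcases m with _ | m
        · simp
        · simp
      rw [e, e0]
      exact h2 _ (by omega)
  · intro i hi
    simp only [Nat.mod_eq_of_lt (show i < m + 1 by omega)]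
  · simp

lemma ClockPolygon.verts_mod_succ (Q : ClockPolygon) (i : ℕ) :
    Q.verts (i % Q.n + 1) = Q.verts (i + 1) := by
  rw [Q.verts_eq_iff]; simp [Nat.add_mod]

lemma exists_poly (m : ℕ) (x : ℕ → ℝ × ℝ)
    (hinj : ∀ i j, i ≤ m → j ≤ m → x i = x j → i = j)
    (h1 : ∀ i < m, ∀ j ≤ m, det2 (x (i + 1) - x i) (x j - x i) ≤ 0)
    (h2 : ∀ j ≤ m, det2 (x 0 - x m) (x j - x m) ≤ 0) :
    ∃ Q : ClockPolygon, Q.n = m + 1 ∧ Q.body = convexHull ℝ (x '' Set.Iic m) ∧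
      (∀ (M : Type) [AddCommMonoid M] (g : ℝ × ℝ → ℝ × ℝ → M),
        ∑ i ∈ Finset.range Q.n, g (Q.verts i) (Q.verts (i + 1)) =
        ∑ i ∈ Finset.range m, g (x i) (x (i + 1)) + g (x m) (x 0)) ∧
      (∀ R : ℝ × ℝ → ℝ × ℝ → Prop, (∀ i < m, R (x i) (x (i + 1))) → R (x m) (x 0) →
        ∀ i, R (Q.verts i) (Q.verts (i + 1))) ∧ (∀ i ≤ m, Q.verts i = x i) := by
  obtain ⟨Q, hn, hv, hl⟩ := exists_ofSeq m x hinj h1 h2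
  refine ⟨Q, hn, ?_, ?_, ?_, hv⟩
  · unfold ClockPolygon.body
    rw [Q.range_eq_image, hn]
    congr 1
    apply Set.Subset.antisymm
    · rintro _ ⟨i, hi, rfl⟩
      have hi' : i ≤ m := Nat.lt_succ_iff.1 hi
      exact ⟨i, hi', (hv i hi').symm⟩
    · rintro _ ⟨i, hi, rfl⟩
      exact ⟨i, Nat.lt_succ_iff.2 hi, hv i hi⟩
  · intro M _ g
    rw [hn, Finset.sum_range_succ, hl, hv m le_rfl]
    congr 1
    apply Finset.sum_congr rfl
    intro i hi
    have := Finset.mem_range.1 hi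
    rw [hv i (by omega), hv (i + 1) (by omega)]
  · intro R hR hR' i
    rw [← Q.verts_mod i, ← Q.verts_mod_succ i]
    have hlt : i % Q.n < Q.n := Nat.mod_lt _ Q.npos
    generalize i % Q.n = k at hlt
    rw [hn] at hlt
    rcases Nat.lt_or_ge k m with h | h
    · rw [hv k (by omega), hv (k + 1) (by omega)]; exact hR k h
    · have : k = m := by omega
      rw [this, hl, hv m le_rfl]; exact hR'

structure Sublin (L : ℝ × ℝ → ℝ) : Prop where
  sub : ∀ u v, L (u + v) ≤ L u + L v
  hom : ∀ (c : ℝ) v, 0 ≤ c → L (c • v) = c * L v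
  nonneg : ∀ v, 0 ≤ L v

lemma Sublin.zero {L : ℝ × ℝ → ℝ} (h : Sublin L) : L 0 = 0 := by
  have := h.hom 0 0 le_rfl; simpa using this

/-- the perimeter with respect to a length function -/
def perimL (L : ℝ × ℝ → ℝ) (Q : ClockPolygon) : ℝ :=
  ∑ i ∈ Finset.range Q.n, L (Q.verts (i + 1) - Q.verts i)

structure Fam (L : ℝ × ℝ → ℝ) (Par : ℝ × ℝ → Prop) (S : Set (ℝ × ℝ)) (c : ℝ)
    (Q : ClockPolygon) : Prop where
  par : ∀ i, Par (Q.verts (i + 1) - Q.verts i)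
  sub : S ⊆ Q.body
  per : perimL L Q ≤ c

lemma Fam.rot {L : ℝ × ℝ → ℝ} {Par : ℝ × ℝ → Prop} {S : Set (ℝ × ℝ)} {c : ℝ}
    {Q : ClockPolygon} (h : Fam L Par S c Q) (s : ℕ) : Fam L Par S c (Q.rot s) where
  par i := by
    have := h.par (i + s)
    simp only [ClockPolygon.rot_verts]
    rwa [show i + 1 + s = i + s + 1 by ring]
  sub := by rw [Q.rot_body]; exact h.sub
  per := by
    have := Q.rot_sum s (fun p q => L (q - p))
    unfold perimL; rw [this]; exact h.per

lemma path_le {L : ℝ × ℝ → ℝ} (hL : Sublin L) (v : ℕ → ℝ × ℝ) (a k : ℕ) :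
    L (v (a + k) - v a) ≤ ∑ i ∈ Finset.range k, L (v (a + i + 1) - v (a + i)) := by
  induction k with
  | zero => simp [hL.zero]
  | succ k ih =>
    rw [Finset.sum_range_succ]
    have := hL.sub (v (a + k) - v a) (v (a + k + 1) - v (a + k))
    rw [show v (a + k) - v a + (v (a + k + 1) - v (a + k)) = v (a + (k + 1)) - v a by
      rw [← add_assoc]; abel] at this
    linarith

/-- dropping the last vertex -/
lemma drop_last {L : ℝ × ℝ → ℝ} {Par : ℝ × ℝ → Prop} {S : Set (ℝ × ℝ)} {c : ℝ}
    {Q : ClockPolygon} (hL : Sublin L) (h : Fam L Par S c Q) (m : ℕ) (hn : Q.n = m + 2)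
    (hmem : Q.verts (m + 1) ∈ convexHull ℝ (Q.verts '' Set.Iic m))
    (hcw : ∀ y ∈ Q.body, det2 (Q.verts 0 - Q.verts m) (y - Q.verts m) ≤ 0)
    (hpar : Par (Q.verts 0 - Q.verts m)) :
    ∃ Q' : ClockPolygon, Fam L Par S c Q' ∧ Q'.n < Q.n := by
  obtain ⟨Q', h1, h2, h3, h4, -⟩ := exists_poly m Q.verts
    (fun i j hi hj => Q.inj i j (by omega) (by omega))
    (fun i _ j _ => Q.cw i (Q.vert_mem j)) (fun j _ => hcw _ (Q.vert_mem j))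
  refine ⟨Q', ⟨?_, ?_, ?_⟩, by omega⟩
  · exact h4 (fun p q => Par (q - p)) (fun i _ => h.par i) hpar
  · refine h.sub.trans ?_
    rw [h2]
    refine convexHull_min ?_ (convex_convexHull ℝ _)
    rw [Q.range_eq_image]
    rintro _ ⟨i, hi, rfl⟩
    rw [Set.mem_Iio, hn] at hi
    rcases Nat.lt_or_ge i (m + 1) with hlt | hge
    · exact subset_convexHull ℝ _ ⟨i, Nat.lt_succ_iff.1 hlt, rfl⟩
    · rw [show i = m + 1 by omega]; exact hmem
  · refine le_trans ?_ h.per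
    unfold perimL
    rw [h3 ℝ (fun p q => L (q - p)), hn, Finset.sum_range_succ, Finset.sum_range_succ]
    have e : Q.verts (m + 1 + 1) = Q.verts 0 := by
      have := Q.periodic 0
      rw [hn, zero_add] at this; exact this
    rw [e, add_assoc]
    have := hL.sub (Q.verts (m + 1) - Q.verts m) (Q.verts 0 - Q.verts (m + 1))
    rw [show Q.verts (m + 1) - Q.verts m + (Q.verts 0 - Q.verts (m + 1)) =
      Q.verts 0 - Q.verts m by abel] at this
    linarith

def Degen (Q : ClockPolygon) : Prop :=
  ∃ w u : ℝ × ℝ, u ≠ 0 ∧ ∀ k, det2 u (Q.verts k - w) = 0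

/-- In a vertex-minimal nondegenerate polygon no vertex is strictly between two others. -/
lemma not_between {L : ℝ × ℝ → ℝ} {Par : ℝ × ℝ → Prop} {S : Set (ℝ × ℝ)} {c : ℝ}
    {Q : ClockPolygon} (hL : Sublin L) (hPar : ∀ (t : ℝ) v, Par v → Par (t • v))
    (h : Fam L Par S c Q)
    (hmin : ∀ Q' : ClockPolygon, Fam L Par S c Q' → Q.n ≤ Q'.n) (hdeg : ¬ Degen Q)
    (i j k : ℕ) (s : ℝ) (hs0 : 0 < s) (hs1 : s < 1) (hne : Q.verts j ≠ Q.verts k)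
    (heq : Q.verts i = (1 - s) • Q.verts j + s • Q.verts k) : False := by
  have hn2 : 2 ≤ Q.n := by
    by_contra hlt
    have := Q.npos
    have h1 : Q.n = 1 := by omega
    apply hne
    rw [Q.verts_eq_iff, h1]; omega
  obtain ⟨m, hm⟩ : ∃ m, Q.n = m + 2 := ⟨Q.n - 2, by omega⟩
  -- rotated polygon
  set P := Q.rot (i + 1) with hP
  have hPf : Fam L Par S c P := h.rot _
  have hPn : P.n = m + 2 := hm
  have hvl : P.verts (m + 1) = Q.verts i := by
    rw [hP, Q.rot_verts, show m + 1 + (i + 1) = i + Q.n by omega, Q.periodic]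
  have hv0 : P.verts (m + 2) = P.verts 0 := by
    have := P.periodic 0
    rwa [hPn, zero_add] at this
  obtain ⟨j', hj'⟩ : ∃ j', P.verts j' = Q.verts j := by
    have : Q.verts j ∈ Set.range (fun l => Q.verts (l + (i + 1))) := by
      rw [Q.range_rot]; exact ⟨j, rfl⟩
    exact this
  obtain ⟨k', hk'⟩ : ∃ k', P.verts k' = Q.verts k := by
    have : Q.verts k ∈ Set.range (fun l => Q.verts (l + (i + 1))) := by
      rw [Q.range_rot]; exact ⟨k, rfl⟩
    exact this
  rw [← hj', ← hk'] at heq hne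
  rw [← hvl] at heq
  set u := P.verts k' - P.verts j' with hu
  have hu0 : u ≠ 0 := sub_ne_zero.2 hne.symm
  set M := P.verts (m + 1) with hM
  have eb : P.verts k' - M = (1 - s) • u := by rw [heq, hu]; module
  have ea : P.verts j' - M = (-s) • u := by rw [heq, hu]; module
  have key : ∀ d : ℝ × ℝ, (∀ q ∈ P.body, det2 d (q - M) ≤ 0) → det2 d u = 0 := by
    intro d hd
    have h1 := hd _ (P.vert_mem k')
    have h2 := hd _ (P.vert_mem j')
    rw [eb, det2_smul_right] at h1
    rw [ea, det2_smul_right] at h2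
    have h3 : det2 d u ≤ 0 := by
      by_contra hc; push Not at hc
      have : 0 < (1 - s) * det2 d u := mul_pos (by linarith) hc
      linarith
    have h4 : 0 ≤ det2 d u := by
      by_contra hc; push Not at hc
      have : 0 < s * (-det2 d u) := mul_pos hs0 (by linarith)
      linarith
    linarith
  have swap : ∀ a b : ℝ × ℝ, det2 a b = - det2 b a := by
    intro a b; simp only [det2]; ring
  have k1 := key _ (fun q hq => P.cw' m hq)
  have k2 := key _ (fun q hq => P.cw (m + 1) hq)
  rw [swap, neg_eq_zero] at k1 k2
  obtain ⟨α, hα⟩ := exists_smul_of_det2_eq_zero hu0 k1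
  obtain ⟨β, hβ⟩ := exists_smul_of_det2_eq_zero hu0 k2
  have hα0 : α ≠ 0 := by
    rintro rfl
    exact P.edge_ne (by omega) m (sub_eq_zero.1 (by rw [hα, zero_smul]))
  have hβ0 : β ≠ 0 := by
    rintro rfl
    exact P.edge_ne (by omega) (m + 1) (sub_eq_zero.1 (by rw [hβ, zero_smul]))
  -- a vertex off the line
  obtain ⟨r, hr⟩ : ∃ r, det2 u (P.verts r - M) ≠ 0 := by
    by_contra hc
    push Not at hc
    apply hdeg
    refine ⟨M, u, hu0, fun l => ?_⟩
    have : Q.verts l ∈ Set.range (fun l => Q.verts (l + (i + 1))) := by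
      rw [Q.range_rot]; exact ⟨l, rfl⟩
    obtain ⟨l', hl'⟩ := this
    rw [← hl']; exact hc l'
  have r1 := P.cw' m (P.vert_mem r)
  have r2 := P.cw (m + 1) (P.vert_mem r)
  rw [hα, det2_smul_left] at r1
  rw [hβ, det2_smul_left] at r2
  have hratio : 0 < β / α := by
    rcases lt_or_gt_of_ne hr with hneg | hpos
    · have a1 : 0 < α := lt_of_le_of_ne (by by_contra hc; push Not at hc; nlinarith [mul_pos_of_neg_of_neg hc hneg]) hα0.symm
      have a2 : 0 < β := lt_of_le_of_ne (by by_contra hc; push Not at hc; nlinarith [mul_pos_of_neg_of_neg hc hneg]) hβ0.symm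
      positivity
    · have a1 : α < 0 := lt_of_le_of_ne (by by_contra hc; push Not at hc; nlinarith [mul_pos hc hpos]) hα0
      have a2 : β < 0 := lt_of_le_of_ne (by by_contra hc; push Not at hc; nlinarith [mul_pos hc hpos]) hβ0
      exact div_pos_of_neg_of_neg a2 a1
  have hedge : P.verts 0 - P.verts m = (1 + β / α) • (P.verts (m + 1) - P.verts m) := by
    have : P.verts 0 - P.verts m = (P.verts (m + 1) - P.verts m) +
      (P.verts (m + 1 + 1) - P.verts (m + 1)) := by
      rw [show m + 1 + 1 = m + 2 from rfl, hv0]; abel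
    rw [this, hα, hβ, smul_smul, ← add_smul]
    congr 1; field_simp
  obtain ⟨Q', hQ', hlt⟩ := drop_last hL hPf m hPn (by
      have mem : ∀ l, P.verts l ≠ M → P.verts l ∈ convexHull ℝ (P.verts '' Set.Iic m) := by
        intro l hl
        apply subset_convexHull
        refine ⟨l % P.n, ?_, P.verts_mod l⟩
        have h1 := Nat.mod_lt l P.npos
        have h2 : l % P.n ≠ m + 1 := by
          intro hc; apply hl; rw [hM, ← hc, P.verts_mod]
        simp only [Set.mem_Iic]; omega
      have m1 := mem j' (by
        intro hc
        have := sub_eq_zero.2 hc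
        rw [ea] at this
        rcases smul_eq_zero.1 this with h | h
        · linarith
        · exact hu0 h)
      have m2 := mem k' (by
        intro hc
        have := sub_eq_zero.2 hc
        rw [eb] at this
        rcases smul_eq_zero.1 this with h | h
        · linarith
        · exact hu0 h)
      rw [← hM, heq]
      exact convex_convexHull ℝ _ m1 m2 (by linarith) hs0.le (by ring))
    (by
      intro y hy
      rw [hedge, det2_smul_left]
      have := P.cw m hy
      have : 0 ≤ 1 + β / α := by linarith
      nlinarith)
    (by rw [hedge]; exact hPar _ _ (hPf.par m))
  have := hmin Q' hQ'
  rw [hPn] at hlt; omega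

def Strong (Q : ClockPolygon) : Prop :=
  ∀ i k, Q.verts k ≠ Q.verts i → Q.verts k ≠ Q.verts (i + 1) →
    det2 (Q.verts (i + 1) - Q.verts i) (Q.verts k - Q.verts i) < 0

lemma Strong.rot {Q : ClockPolygon} (h : Strong Q) (s : ℕ) : Strong (Q.rot s) := by
  intro i k h1 h2
  simp only [ClockPolygon.rot_verts] at *
  rw [show i + 1 + s = i + s + 1 by ring] at *
  exact h _ _ h1 h2

lemma strong_of_min {L : ℝ × ℝ → ℝ} {Par : ℝ × ℝ → Prop} {S : Set (ℝ × ℝ)} {c : ℝ}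
    {Q : ClockPolygon} (hL : Sublin L) (hPar : ∀ (t : ℝ) v, Par v → Par (t • v))
    (h : Fam L Par S c Q)
    (hmin : ∀ Q' : ClockPolygon, Fam L Par S c Q' → Q.n ≤ Q'.n) (hdeg : ¬ Degen Q) :
    Strong Q := by
  intro i k h1 h2
  refine lt_of_le_of_ne (Q.cw i (Q.vert_mem k)) ?_
  intro h0
  have hn2 : 2 ≤ Q.n := by
    by_contra hlt
    have := Q.npos
    have h1' : Q.n = 1 := by omega
    apply h1
    rw [Q.verts_eq_iff, h1']; omega
  have he := Q.edge_ne hn2 i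
  have nb := not_between hL hPar h hmin hdeg
  obtain ⟨s, hs⟩ := exists_smul_of_det2_eq_zero (sub_ne_zero.2 he) h0
  have hvk : Q.verts k = Q.verts i + s • (Q.verts (i + 1) - Q.verts i) := by
    rw [← hs]; abel
  rcases lt_trichotomy s 0 with hs0 | hs0 | hs0
  · -- i between k and i+1
    refine nb i k (i + 1) (-s / (1 - s)) (div_pos (by linarith) (by linarith))
      (by rw [div_lt_one (by linarith)]; linarith) h2 ?_
    have h1s : (1 - s) ≠ 0 := by linarith
    rw [hvk]
    ext
    · simp only [Prod.fst_add, Prod.smul_fst, Prod.fst_sub, smul_eq_mul]; field_simp; ring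
    · simp only [Prod.snd_add, Prod.smul_snd, Prod.snd_sub, smul_eq_mul]; field_simp; ring
  · apply h1; rw [hvk, hs0]; simp
  · rcases lt_trichotomy s 1 with hs1 | hs1 | hs1
    · refine nb k i (i + 1) s hs0 hs1 he.symm ?_
      rw [hvk]; module
    · apply h2; rw [hvk, hs1]; simp
    · refine nb (i + 1) i k (1 / s) (by positivity) (by rw [div_lt_one hs0]; exact hs1)
        (Ne.symm h1) ?_
      rw [hvk]
      ext
      · simp only [Prod.fst_add, Prod.smul_fst, Prod.fst_sub, smul_eq_mul]; field_simp; ring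
      · simp only [Prod.snd_add, Prod.smul_snd, Prod.snd_sub, smul_eq_mul]; field_simp; ring

lemma between_aux {A P R z : ℝ × ℝ} {μ : ℝ}
    (fA : det2 (R - P) (A - P) < 0)
    (hd1 : det2 (P - A) (R - A) < 0)
    (hz : det2 (R - P) (z - P) = μ)
    (hz1 : det2 (P - A) (z - A) ≤ 0) :
    ∃ s : ℝ, z = P + (μ / det2 (R - P) (A - P)) • (A - P) + s • (R - P) ∧ 0 ≤ s ∧
      (det2 (P - A) (z - A) < 0 → 0 < s) := by
  have hd0 : R - P ≠ 0 := by
    intro h; rw [h] at fA; simp [det2] at fA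
  have e : det2 (R - P) (z - (P + (μ / det2 (R - P) (A - P)) • (A - P))) = 0 := by
    rw [sub_add_eq_sub_sub, det2_sub_right, hz, det2_smul_right,
      div_mul_cancel₀ _ fA.ne, sub_self]
  obtain ⟨s, hs⟩ := exists_smul_of_det2_eq_zero hd0 e
  have hz' : z = P + (μ / det2 (R - P) (A - P)) • (A - P) + s • (R - P) := by
    rw [← hs]; abel
  have e2 : det2 (P - A) (z - A) = s * det2 (P - A) (R - A) := by
    rw [hz']
    simp only [det2, Prod.fst_sub, Prod.snd_sub, Prod.fst_add, Prod.snd_add, Prod.smul_fst,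
      Prod.smul_snd, smul_eq_mul]
    ring
  refine ⟨s, hz', ?_, ?_⟩
  · by_contra hc; push Not at hc
    have := mul_pos_of_neg_of_neg hc hd1
    linarith
  · intro hlt
    by_contra hc; push Not at hc
    have := mul_nonneg_of_nonpos_of_nonpos hc hd1.le
    linarith

/-- horizontal slices between the two neighbouring edges -/
lemma between {A P R B z : ℝ × ℝ} {μ : ℝ}
    (fA : det2 (R - P) (A - P) < 0) (fB : det2 (R - P) (B - P) < 0)
    (hd1 : det2 (P - A) (R - A) < 0) (hd2 : det2 (B - R) (P - R) < 0)
    (hz : det2 (R - P) (z - P) = μ)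
    (hz1 : det2 (P - A) (z - A) ≤ 0) (hz2 : det2 (B - R) (z - R) ≤ 0) :
    ∃ s r : ℝ, z = P + (μ / det2 (R - P) (A - P)) • (A - P) + s • (R - P) ∧
      R + (μ / det2 (R - P) (B - P)) • (B - R) = z + r • (R - P) ∧ 0 ≤ s ∧ 0 ≤ r ∧
      (det2 (P - A) (z - A) < 0 → 0 < s) ∧ (det2 (B - R) (z - R) < 0 → 0 < r) := by
  obtain ⟨s, h1, h2, h3⟩ := between_aux fA hd1 hz hz1
  have hd0 : R - P ≠ 0 := by
    intro h; rw [h] at fA; simp [det2] at fA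
  have eB : det2 (R - P) (B - R) = det2 (R - P) (B - P) := by
    simp only [det2, Prod.fst_sub, Prod.snd_sub]; ring
  have eR : det2 (R - P) (R - z) = - μ := by
    rw [← hz]; simp only [det2, Prod.fst_sub, Prod.snd_sub]; ring
  have e : det2 (R - P) (R + (μ / det2 (R - P) (B - P)) • (B - R) - z) = 0 := by
    rw [add_sub_right_comm, det2_add_right, det2_smul_right, eB, eR,
      div_mul_cancel₀ _ fB.ne]; ring
  obtain ⟨r, hr⟩ := exists_smul_of_det2_eq_zero hd0 e
  have e2 : det2 (B - R) (z - R) = r * det2 (B - R) (P - R) := by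
    have : z = R + (μ / det2 (R - P) (B - P)) • (B - R) - r • (R - P) := by rw [← hr]; abel
    rw [this]
    simp only [det2, Prod.fst_sub, Prod.snd_sub, Prod.fst_add, Prod.snd_add, Prod.smul_fst,
      Prod.smul_snd, smul_eq_mul]
    ring
  refine ⟨s, r, h1, by rw [← hr]; abel, h2, ?_, h3, ?_⟩
  · by_contra hc; push Not at hc
    have := mul_pos_of_neg_of_neg hc hd2
    linarith
  · intro hlt
    by_contra hc; push Not at hc
    have := mul_nonneg_of_nonpos_of_nonpos hc hd2.le
    linarith

lemma mem_segment_of_between {p q z d : ℝ × ℝ} {s r : ℝ} (hs : 0 ≤ s) (hr : 0 ≤ r)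
    (h1 : z = p + s • d) (h2 : q = z + r • d) : z ∈ segment ℝ p q := by
  rcases eq_or_lt_of_le (add_nonneg hs hr) with h0 | h0
  · have : s = 0 := by linarith
    rw [h1, this, zero_smul, add_zero]; exact left_mem_segment ℝ _ _
  · refine ⟨r / (s + r), s / (s + r), by positivity, by positivity, by field_simp; ring, ?_⟩
    rw [h2, h1]
    ext
    · simp only [Prod.fst_add, Prod.smul_fst, smul_eq_mul]; field_simp; ring
    · simp only [Prod.snd_add, Prod.smul_snd, smul_eq_mul]; field_simp; ring

lemma tail1 (Q : ClockPolygon) (N : ℕ) (hn : N + 1 ≤ Q.n) (p : ℝ × ℝ) (hp : p ∈ Q.body)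
    (hpn : ∀ j ≤ N, Q.verts j ≠ p)
    (cA : ∀ y, (∃ j ≤ N, y = Q.verts j) ∨ y = p → det2 (p - Q.verts N) (y - Q.verts N) ≤ 0)
    (cB : ∀ y, (∃ j ≤ N, y = Q.verts j) ∨ y = p → det2 (Q.verts 0 - p) (y - p) ≤ 0) :
    ∃ Q' : ClockPolygon, Q'.n = N + 2 ∧
      Q'.body = convexHull ℝ (Q.verts '' Set.Iic N ∪ {p}) ∧
      (∀ g : ℝ × ℝ → ℝ × ℝ → ℝ,
        ∑ i ∈ Finset.range Q'.n, g (Q'.verts i) (Q'.verts (i + 1)) =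
        ∑ i ∈ Finset.range N, g (Q.verts i) (Q.verts (i + 1)) + g (Q.verts N) p
          + g p (Q.verts 0)) ∧
      (∀ W : ℝ × ℝ → ℝ × ℝ → Prop, (∀ i < N, W (Q.verts i) (Q.verts (i + 1))) →
        W (Q.verts N) p → W p (Q.verts 0) →
        ∀ i, W (Q'.verts i) (Q'.verts (i + 1))) := by
  set x : ℕ → ℝ × ℝ := fun k => if k ≤ N then Q.verts k else p with hx
  have x1 : ∀ k ≤ N, x k = Q.verts k := fun k hk => by simp [hx, hk]
  have x2 : x (N + 1) = p := by simp [hx]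
  have xc : ∀ j ≤ N + 1, (∃ j' ≤ N, x j = Q.verts j') ∨ x j = p := by
    intro j hj
    rcases Nat.lt_or_ge j (N + 1) with h | h
    · exact Or.inl ⟨j, by omega, x1 j (by omega)⟩
    · right; rw [show j = N + 1 by omega, x2]
  have xb : ∀ j ≤ N + 1, x j ∈ Q.body := by
    intro j hj
    rcases xc j hj with ⟨j', _, h⟩ | h
    · rw [h]; exact Q.vert_mem _
    · rw [h]; exact hp
  obtain ⟨Q', h1, h2, h3, h4, -⟩ := exists_poly (N + 1) x
    (by
      intro i j hi hj hij
      rcases Nat.lt_or_ge i (N + 1) with h | h <;> rcases Nat.lt_or_ge j (N + 1) with h' | h'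
      · rw [x1 i (by omega), x1 j (by omega)] at hij
        exact Q.inj i j (by omega) (by omega) hij
      · rw [x1 i (by omega), show j = N + 1 by omega, x2] at hij
        exact absurd hij (hpn i (by omega))
      · rw [x1 j (by omega), show i = N + 1 by omega, x2] at hij
        exact absurd hij.symm (hpn j (by omega))
      · omega)
    (by
      intro i hi j hj
      rcases Nat.lt_or_ge i N with h | h
      · rw [x1 (i + 1) (by omega), x1 i (by omega)]
        exact Q.cw i (xb j hj)
      · rw [show i = N by omega, x2, x1 N le_rfl]
        exact cA _ (xc j hj))
    (by
      intro j hj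
      rw [x2, x1 0 (by omega)]
      exact cB _ (xc j hj))
  refine ⟨Q', h1, ?_, ?_, ?_⟩
  · rw [h2]
    congr 1
    ext y
    constructor
    · rintro ⟨j, hj, rfl⟩
      rcases xc j hj with ⟨j', hj', h⟩ | h
      · left; exact ⟨j', hj', h.symm⟩
      · right; exact h
    · rintro (⟨j, hj, rfl⟩ | h)
      · exact ⟨j, Nat.le_succ_of_le hj, x1 j hj⟩
      · exact ⟨N + 1, Set.mem_Iic.2 le_rfl, by rw [x2]; exact h.symm⟩
  · intro g
    rw [h3 ℝ g, Finset.sum_range_succ, x2, x1 N le_rfl, x1 0 (by omega)]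
    congr 2
    apply Finset.sum_congr rfl
    intro i hi
    have := Finset.mem_range.1 hi
    rw [x1 i (by omega), x1 (i + 1) (by omega)]
  · intro W w1 w2 w3
    apply h4 W
    · intro i hi
      rcases Nat.lt_or_ge i N with h | h
      · rw [x1 (i + 1) (by omega), x1 i (by omega)]; exact w1 i h
      · rw [show i = N by omega, x2, x1 N le_rfl]; exact w2
    · rw [x2, x1 0 (by omega)]; exact w3

lemma tail2 (Q : ClockPolygon) (N : ℕ) (hn : N + 1 ≤ Q.n) (p q : ℝ × ℝ) (hp : p ∈ Q.body)
    (hq : q ∈ Q.body)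
    (hpn : ∀ j ≤ N, Q.verts j ≠ p) (hqn : ∀ j ≤ N, Q.verts j ≠ q) (hpq : p ≠ q)
    (cA : ∀ y, (∃ j ≤ N, y = Q.verts j) ∨ y = p ∨ y = q →
      det2 (p - Q.verts N) (y - Q.verts N) ≤ 0)
    (cM : ∀ y, (∃ j ≤ N, y = Q.verts j) ∨ y = p ∨ y = q → det2 (q - p) (y - p) ≤ 0)
    (cB : ∀ y, (∃ j ≤ N, y = Q.verts j) ∨ y = p ∨ y = q → det2 (Q.verts 0 - q) (y - q) ≤ 0) :
    ∃ Q' : ClockPolygon, Q'.n = N + 3 ∧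
      Q'.body = convexHull ℝ (Q.verts '' Set.Iic N ∪ {p, q}) ∧
      (∀ (M : Type) [AddCommMonoid M] (g : ℝ × ℝ → ℝ × ℝ → M),
        ∑ i ∈ Finset.range Q'.n, g (Q'.verts i) (Q'.verts (i + 1)) =
        ∑ i ∈ Finset.range N, g (Q.verts i) (Q.verts (i + 1)) + g (Q.verts N) p
          + g p q + g q (Q.verts 0)) ∧
      (∀ W : ℝ × ℝ → ℝ × ℝ → Prop, (∀ i < N, W (Q.verts i) (Q.verts (i + 1))) →
        W (Q.verts N) p → W p q → W q (Q.verts 0) →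
        ∀ i, W (Q'.verts i) (Q'.verts (i + 1))) := by
  set x : ℕ → ℝ × ℝ := fun k => if k ≤ N then Q.verts k else if k = N + 1 then p else q with hx
  have x1 : ∀ k ≤ N, x k = Q.verts k := fun k hk => by simp [hx, hk]
  have x2 : x (N + 1) = p := by simp [hx]
  have x3 : x (N + 2) = q := by simp [hx]
  have xc : ∀ j ≤ N + 2, (∃ j' ≤ N, x j = Q.verts j') ∨ x j = p ∨ x j = q := by
    intro j hj
    rcases Nat.lt_or_ge j (N + 1) with h | h
    · exact Or.inl ⟨j, by omega, x1 j (by omega)⟩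
    · rcases Nat.lt_or_ge j (N + 2) with h' | h'
      · right; left; rw [show j = N + 1 by omega, x2]
      · right; right; rw [show j = N + 2 by omega, x3]
  have xb : ∀ j ≤ N + 2, x j ∈ Q.body := by
    intro j hj
    rcases xc j hj with ⟨j', _, h⟩ | h | h
    · rw [h]; exact Q.vert_mem _
    · rw [h]; exact hp
    · rw [h]; exact hq
  have xlt : ∀ i j, i < j → j ≤ N + 2 → x i ≠ x j := by
    intro i j hij hj h
    rcases Nat.lt_or_ge j (N + 1) with h1 | h1
    · rw [x1 i (by omega), x1 j (by omega)] at h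
      have := Q.inj i j (by omega) (by omega) h
      omega
    · rcases Nat.lt_or_ge i (N + 1) with h2 | h2
      · rw [x1 i (by omega)] at h
        rcases Nat.lt_or_ge j (N + 2) with h3 | h3
        · rw [show j = N + 1 by omega, x2] at h; exact hpn i (by omega) h
        · rw [show j = N + 2 by omega, x3] at h; exact hqn i (by omega) h
      · rw [show i = N + 1 by omega, show j = N + 2 by omega, x2, x3] at h
        exact hpq h
  obtain ⟨Q', h1, h2, h3, h4, -⟩ := exists_poly (N + 2) x
    (by
      intro i j hi hj hij
      rcases lt_trichotomy i j with h | h | h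
      · exact absurd hij (xlt i j h hj)
      · exact h
      · exact absurd hij.symm (xlt j i h hi))
    (by
      intro i hi j hj
      rcases Nat.lt_or_ge i N with h | h
      · rw [x1 (i + 1) (by omega), x1 i (by omega)]
        exact Q.cw i (xb j hj)
      · rcases Nat.lt_or_ge i (N + 1) with h' | h'
        · rw [show i = N by omega, x2, x1 N le_rfl]
          exact cA _ (xc j hj)
        · rw [show i = N + 1 by omega, x2, x3]
          exact cM _ (xc j hj))
    (by
      intro j hj
      rw [x3, x1 0 (by omega)]
      exact cB _ (xc j hj))
  refine ⟨Q', h1, ?_, ?_, ?_⟩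
  · rw [h2]
    congr 1
    ext y
    constructor
    · rintro ⟨j, hj, rfl⟩
      rcases xc j hj with ⟨j', hj', h⟩ | h | h
      · left; exact ⟨j', hj', h.symm⟩
      · right; left; exact h
      · right; right; exact h
    · rintro (⟨j, hj, rfl⟩ | h | h)
      · exact ⟨j, Nat.le_add_right_of_le hj, x1 j hj⟩
      · exact ⟨N + 1, by simp, by rw [x2]; exact h.symm⟩
      · exact ⟨N + 2, Set.mem_Iic.2 le_rfl, by rw [x3]; exact h.symm⟩
  · intro M _ g
    rw [h3 M g, Finset.sum_range_succ, Finset.sum_range_succ, x2, x3, x1 N le_rfl,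
      x1 0 (by omega)]
    congr 3
    apply Finset.sum_congr rfl
    intro i hi
    have := Finset.mem_range.1 hi
    rw [x1 i (by omega), x1 (i + 1) (by omega)]
  · intro W w1 w2 w3 w4
    apply h4 W
    · intro i hi
      rcases Nat.lt_or_ge i N with h | h
      · rw [x1 (i + 1) (by omega), x1 i (by omega)]; exact w1 i h
      · rcases Nat.lt_or_ge i (N + 1) with h' | h'
        · rw [show i = N by omega, x2, x1 N le_rfl]; exact w2
        · rw [show i = N + 1 by omega, x2, x3]; exact w3
    · rw [x3, x1 0 (by omega)]; exact w4

/-- Replace the last two vertices by `p, q`, allowing collapses. -/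
lemma tail (Q : ClockPolygon) (N : ℕ) (hn : Q.n = N + 3) (p q : ℝ × ℝ) (hp : p ∈ Q.body)
    (hq : q ∈ Q.body)
    (hpn : ∀ j ≤ N, Q.verts j = p → p = Q.verts N)
    (hqn : ∀ j ≤ N, Q.verts j = q → q = Q.verts 0)
    (cA : ∀ y, (∃ j ≤ N, y = Q.verts j) ∨ y = p ∨ y = q →
      det2 (p - Q.verts N) (y - Q.verts N) ≤ 0)
    (cM : ∀ y, (∃ j ≤ N, y = Q.verts j) ∨ y = p ∨ y = q → det2 (q - p) (y - p) ≤ 0)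
    (cB : ∀ y, (∃ j ≤ N, y = Q.verts j) ∨ y = p ∨ y = q → det2 (Q.verts 0 - q) (y - q) ≤ 0) :
    ∃ Q' : ClockPolygon,
      Q'.body = convexHull ℝ (Q.verts '' Set.Iic N ∪ {p, q}) ∧
      (∀ g : ℝ × ℝ → ℝ × ℝ → ℝ, (∀ x, g x x = 0) →
        ∑ i ∈ Finset.range Q'.n, g (Q'.verts i) (Q'.verts (i + 1)) =
        ∑ i ∈ Finset.range N, g (Q.verts i) (Q.verts (i + 1)) + g (Q.verts N) p
          + g p q + g q (Q.verts 0)) ∧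
      (∀ W : ℝ × ℝ → ℝ × ℝ → Prop, (∀ i < N, W (Q.verts i) (Q.verts (i + 1))) →
        W (Q.verts N) p → W p q → W q (Q.verts 0) →
        ∀ i, W (Q'.verts i) (Q'.verts (i + 1))) ∧
      (Q'.n < Q.n ∨ (Q'.n = Q.n ∧ p ≠ Q.verts N ∧ q ≠ Q.verts 0 ∧
        ∀ g : ℝ × ℝ → ℝ × ℝ → ℕ,
        ∑ i ∈ Finset.range Q'.n, g (Q'.verts i) (Q'.verts (i + 1)) =
        ∑ i ∈ Finset.range N, g (Q.verts i) (Q.verts (i + 1)) + g (Q.verts N) p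
          + g p q + g q (Q.verts 0))) := by
  by_cases hpA : p = Q.verts N
  · by_cases hqB : q = Q.verts 0
    · subst hpA hqB
      obtain ⟨Q', h1, h2, h3, h4, -⟩ := exists_poly N Q.verts
        (fun i j hi hj => Q.inj i j (by omega) (by omega))
        (fun i _ j _ => Q.cw i (Q.vert_mem j)) (fun j hj => cM _ (Or.inl ⟨j, hj, rfl⟩))
      refine ⟨Q', ?_, ?_, ?_, Or.inl (by omega)⟩
      · rw [h2]
        congr 1
        symm
        apply Set.union_eq_left.2
        rintro y (rfl | rfl)
        · exact ⟨N, Set.mem_Iic.2 le_rfl, rfl⟩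
        · exact ⟨0, by simp, rfl⟩
      · intro g hg
        rw [h3 ℝ g, hg, hg]; ring
      · intro W w1 w2 w3 w4
        exact h4 W w1 w3
    · subst hpA
      have hqn' : ∀ j ≤ N, Q.verts j ≠ q := fun j hj h => hqB (hqn j hj h)
      obtain ⟨Q', h1, h2, h3, h4⟩ := tail1 Q N (by omega) q hq hqn'
        (fun y hy => cM y (hy.imp_right Or.inr)) (fun y hy => cB y (hy.imp_right Or.inr))
      refine ⟨Q', ?_, ?_, ?_, Or.inl (by omega)⟩
      · rw [h2]
        congr 1
        ext y
        simp only [Set.mem_union, Set.mem_insert_iff, Set.mem_singleton_iff]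
        constructor
        · rintro (h | h)
          · exact Or.inl h
          · exact Or.inr (Or.inr h)
        · rintro (h | h | h)
          · exact Or.inl h
          · exact Or.inl ⟨N, Set.mem_Iic.2 le_rfl, h.symm⟩
          · exact Or.inr h
      · intro g hg
        rw [h3 g, hg]; ring
      · intro W w1 w2 w3 w4
        exact h4 W w1 w3 w4
  · have hpn' : ∀ j ≤ N, Q.verts j ≠ p := fun j hj h => hpA (hpn j hj h)
    by_cases hqB : q = Q.verts 0
    · subst hqB
      obtain ⟨Q', h1, h2, h3, h4⟩ := tail1 Q N (by omega) p hp hpn'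
        (fun y hy => cA y (hy.imp_right Or.inl)) (fun y hy => cM y (hy.imp_right Or.inl))
      refine ⟨Q', ?_, ?_, ?_, Or.inl (by omega)⟩
      · rw [h2]
        congr 1
        ext y
        simp only [Set.mem_union, Set.mem_insert_iff, Set.mem_singleton_iff]
        constructor
        · rintro (h | h)
          · exact Or.inl h
          · exact Or.inr (Or.inl h)
        · rintro (h | h | h)
          · exact Or.inl h
          · exact Or.inr h
          · exact Or.inl ⟨0, by simp, h.symm⟩
      · intro g hg
        rw [h3 g, hg]; ring
      · intro W w1 w2 w3 w4
        exact h4 W w1 w2 w3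
    · have hqn' : ∀ j ≤ N, Q.verts j ≠ q := fun j hj h => hqB (hqn j hj h)
      by_cases hpq : p = q
      · subst hpq
        obtain ⟨Q', h1, h2, h3, h4⟩ := tail1 Q N (by omega) p hp hpn'
          (fun y hy => cA y (hy.imp_right Or.inl)) (fun y hy => cB y (hy.imp_right Or.inl))
        refine ⟨Q', ?_, ?_, ?_, Or.inl (by omega)⟩
        · rw [h2]; simp
        · intro g hg
          rw [h3 g, hg]; ring
        · intro W w1 w2 w3 w4
          exact h4 W w1 w2 w4
      · obtain ⟨Q', h1, h2, h3, h4⟩ := tail2 Q N (by omega) p q hp hq hpn' hqn' hpq cA cM cB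
        exact ⟨Q', h2, fun g _ => h3 ℝ g, h4, Or.inr ⟨by omega, hpA, hqB, fun g => h3 ℕ g⟩⟩

lemma level_claim {A P R B z e : ℝ × ℝ}
    (fA : det2 (R - P) (A - P) < 0) (fB : det2 (R - P) (B - P) < 0)
    (hd1 : det2 (P - A) (R - A) < 0) (hd2 : det2 (B - R) (P - R) < 0)
    (h1 : det2 (P - A) (z - A) < 0) (h2 : det2 (B - R) (z - R) < 0)
    (hf : det2 (R - P) (z - P) < 0) (he : e ≠ 0)
    (eA : det2 e (A - z) ≤ 0) (eP : det2 e (P - z) ≤ 0) (eR : det2 e (R - z) ≤ 0)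
    (eB : det2 e (B - z) ≤ 0) :
    det2 (R - P) (z - P) ≤ max (det2 (R - P) (A - P)) (det2 (R - P) (B - P)) := by
  by_contra hc
  push Not at hc
  have hcA := (le_max_left _ _).trans_lt hc
  have hcB := (le_max_right _ _).trans_lt hc
  obtain ⟨s, r, hz, hq, -, -, hs, hr⟩ := between fA fB hd1 hd2 rfl h1.le h2.le
  have hs := hs h1
  have hr := hr h2
  set φ := det2 (R - P) (z - P) with hφ
  set a := det2 (R - P) (A - P) with ha
  set b := det2 (R - P) (B - P) with hb
  have t0 : 0 ≤ φ / a := div_nonneg_of_nonpos hf.le fA.le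
  have t1 : φ / a ≤ 1 := by rw [div_le_one_of_neg fA]; exact hcA.le
  have u0 : 0 ≤ φ / b := div_nonneg_of_nonpos hf.le fB.le
  have u1 : φ / b ≤ 1 := by rw [div_le_one_of_neg fB]; exact hcB.le
  have l1 : 0 ≤ s * det2 e (R - P) := by
    have e1 : (-s) • (R - P) = (1 - φ / a) • (P - z) + (φ / a) • (A - z) := by
      have : s • (R - P) = z - P - (φ / a) • (A - P) := by rw [sub_sub, eq_sub_iff_add_eq', ← hz]
      rw [neg_smul, this]; module
    have : det2 e ((-s) • (R - P)) ≤ 0 := by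
      rw [e1, det2_add_right, det2_smul_right, det2_smul_right]
      nlinarith
    rw [det2_smul_right] at this; linarith
  have l2 : r * det2 e (R - P) ≤ 0 := by
    have e1 : r • (R - P) = (1 - φ / b) • (R - z) + (φ / b) • (B - z) := by
      have : r • (R - P) = R + (φ / b) • (B - R) - z := by rw [hq]; abel
      rw [this]; module
    have : det2 e (r • (R - P)) ≤ 0 := by
      rw [e1, det2_add_right, det2_smul_right, det2_smul_right]
      nlinarith
    rwa [det2_smul_right] at this
  have l3 : det2 e (R - P) = 0 := by
    apply le_antisymm
    · by_contra h; push Not at h; linarith [mul_pos hr h]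
    · by_contra h; push Not at h; nlinarith
  have hd0 : R - P ≠ 0 := by
    intro h; rw [ha, h] at fA; simp [det2] at fA
  have l4 : det2 (R - P) e = 0 := by
    have : det2 (R - P) e = - det2 e (R - P) := by simp only [det2]; ring
    rw [this, l3, neg_zero]
  obtain ⟨c, rfl⟩ := exists_smul_of_det2_eq_zero hd0 l4
  rw [det2_smul_left] at eA eP
  have m1 : det2 (R - P) (A - z) = a - φ := by
    rw [ha, hφ]; simp only [det2, Prod.fst_sub, Prod.snd_sub]; ring
  have m2 : det2 (R - P) (P - z) = - φ := by
    rw [hφ]; simp only [det2, Prod.fst_sub, Prod.snd_sub]; ring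
  rw [m1] at eA
  rw [m2] at eP
  have c1 : c ≤ 0 := by
    by_contra h; push Not at h; nlinarith [mul_pos h (neg_pos.2 hf)]
  have c2 : 0 ≤ c := by
    by_contra h; push Not at h; nlinarith [mul_pos_of_neg_of_neg h (sub_neg.2 hcA)]
  apply he
  rw [le_antisymm c1 c2, zero_smul]

open Classical in
def badg (S : Set (ℝ × ℝ)) (p q : ℝ × ℝ) : ℕ := if ∃ s ∈ S, s ∈ segment ℝ p q then 0 else 1

def badc (S : Set (ℝ × ℝ)) (Q : ClockPolygon) : ℕ :=
  ∑ i ∈ Finset.range Q.n, badg S (Q.verts i) (Q.verts (i + 1))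

lemma badg_mono {S : Set (ℝ × ℝ)} {p q p' q' : ℝ × ℝ}
    (h : ∀ s ∈ S, s ∈ segment ℝ p q → s ∈ segment ℝ p' q') : badg S p' q' ≤ badg S p q := by
  unfold badg
  by_cases h1 : ∃ s ∈ S, s ∈ segment ℝ p q
  · have h2 : ∃ s ∈ S, s ∈ segment ℝ p' q' := by
      obtain ⟨s, hs, hs'⟩ := h1; exact ⟨s, hs, h s hs hs'⟩
    rw [if_pos h1, if_pos h2]
  · rw [if_neg h1]; split_ifs <;> omega

lemma push {L : ℝ × ℝ → ℝ} {Par : ℝ × ℝ → Prop} {S : Set (ℝ × ℝ)} {c : ℝ}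
    {Q : ClockPolygon} (hL : Sublin L) (hPar : ∀ (t : ℝ) v, Par v → Par (t • v))
    (hSf : S.Finite) (hSn : S.Nonempty)
    (h : Fam L Par S c Q) (hst : Strong Q) (N : ℕ) (hn : Q.n = N + 3)
    (hbad : ¬ ∃ s ∈ S, s ∈ segment ℝ (Q.verts (N + 1)) (Q.verts (N + 2))) :
    ∃ Q' : ClockPolygon, Fam L Par S c Q' ∧
      (Q'.n < Q.n ∨ (Q'.n = Q.n ∧ badc S Q' < badc S Q)) := by
  have hne : ∀ i j, i < N + 3 → j < N + 3 → i ≠ j → Q.verts i ≠ Q.verts j :=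
    fun i j hi hj hij he => hij (Q.inj i j (by omega) (by omega) he)
  have hB : Q.verts (N + 2 + 1) = Q.verts 0 := by
    have := Q.periodic 0
    rwa [hn, zero_add] at this
  have fA := hst (N + 1) N (hne _ _ (by omega) (by omega) (by omega))
    (hne _ _ (by omega) (by omega) (by omega))
  have fB := hst (N + 1) 0 (hne _ _ (by omega) (by omega) (by omega))
    (hne _ _ (by omega) (by omega) (by omega))
  have hd1 := hst N (N + 2) (hne _ _ (by omega) (by omega) (by omega))
    (hne _ _ (by omega) (by omega) (by omega))
  have hd2 := hst (N + 2) (N + 1) (hne _ _ (by omega) (by omega) (by omega))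
    (by rw [hB]; exact hne _ _ (by omega) (by omega) (by omega))
  have s1 : ∀ j < N, det2 (Q.verts (N + 1) - Q.verts N) (Q.verts j - Q.verts N) < 0 :=
    fun j hj => hst N j (hne _ _ (by omega) (by omega) (by omega))
      (hne _ _ (by omega) (by omega) (by omega))
  have s2 : ∀ j ≤ N, 0 < j →
      det2 (Q.verts (N + 2 + 1) - Q.verts (N + 2)) (Q.verts j - Q.verts (N + 2)) < 0 :=
    fun j hj hj0 => hst (N + 2) j (hne _ _ (by omega) (by omega) (by omega))
      (by rw [hB]; exact hne _ _ (by omega) (by omega) (by omega))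
  have s3 : ∀ j ≤ N,
      det2 (Q.verts (N + 1 + 1) - Q.verts (N + 1)) (Q.verts j - Q.verts (N + 1)) < 0 :=
    fun j hj => hst (N + 1) j (hne _ _ (by omega) (by omega) (by omega))
      (hne _ _ (by omega) (by omega) (by omega))
  have c1 := fun z (hz : z ∈ Q.body) => Q.cw N hz
  have c2 := fun z (hz : z ∈ Q.body) => Q.cw (N + 2) hz
  have c3 := fun z (hz : z ∈ Q.body) => Q.cw (N + 1) hz
  have pA := h.par N
  have pP := h.par (N + 1)
  have pR := h.par (N + 2)
  rw [hB] at hd2 s2 c2 pR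
  rw [show N + 1 + 1 = N + 2 from rfl] at fA fB s3 c3 pP
  have mA := Q.vert_mem N
  have mP := Q.vert_mem (N + 1)
  have mR := Q.vert_mem (N + 2)
  have mB := Q.vert_mem 0
  -- level bound
  have lev : ∀ j ≤ N, det2 (Q.verts (N + 2) - Q.verts (N + 1)) (Q.verts j - Q.verts (N + 1)) ≤
      max (det2 (Q.verts (N + 2) - Q.verts (N + 1)) (Q.verts N - Q.verts (N + 1)))
        (det2 (Q.verts (N + 2) - Q.verts (N + 1)) (Q.verts 0 - Q.verts (N + 1))) := by
    intro j hj
    rcases Nat.eq_zero_or_pos j with h0 | h0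
    · rw [h0]; exact le_max_right _ _
    rcases Nat.lt_or_ge j N with h1 | h1
    · exact level_claim fA fB hd1 hd2 (s1 j h1) (s2 j hj h0) (s3 j hj)
        (sub_ne_zero.2 (Q.edge_ne (by omega) j)) (Q.cw j mA) (Q.cw j mP) (Q.cw j mR) (Q.cw j mB)
    · rw [show j = N by omega]; exact le_max_left _ _
  have perEq : perimL L Q = ∑ i ∈ Finset.range N, L (Q.verts (i + 1) - Q.verts i) +
      L (Q.verts (N + 1) - Q.verts N) + L (Q.verts (N + 2) - Q.verts (N + 1)) +
      L (Q.verts 0 - Q.verts (N + 2)) := by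
    unfold perimL
    rw [hn, Finset.sum_range_succ, Finset.sum_range_succ, Finset.sum_range_succ, hB]
  have badEq : badc S Q = ∑ i ∈ Finset.range N, badg S (Q.verts i) (Q.verts (i + 1)) +
      badg S (Q.verts N) (Q.verts (N + 1)) + badg S (Q.verts (N + 1)) (Q.verts (N + 2)) +
      badg S (Q.verts (N + 2)) (Q.verts 0) := by
    unfold badc
    rw [hn, Finset.sum_range_succ, Finset.sum_range_succ, Finset.sum_range_succ, hB]
  have bodyEq : Q.body = convexHull ℝ ({Q.verts (N + 1), Q.verts (N + 2)} ∪
      Q.verts '' Set.Iic N) := by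
    unfold ClockPolygon.body
    rw [Q.range_eq_image, hn]
    congr 1
    ext y
    simp only [Set.mem_image, Set.mem_union, Set.mem_insert_iff, Set.mem_singleton_iff,
      Set.mem_Iio, Set.mem_Iic]
    constructor
    · rintro ⟨i, hi, rfl⟩
      rcases Nat.lt_or_ge i (N + 1) with h1 | h1
      · exact Or.inr ⟨i, by omega, rfl⟩
      · rcases Nat.lt_or_ge i (N + 2) with h2 | h2
        · rw [show i = N + 1 by omega]; exact Or.inl (Or.inl rfl)
        · rw [show i = N + 2 by omega]; exact Or.inl (Or.inr rfl)
    · rintro ((h | h) | ⟨i, hi, h⟩)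
      · exact ⟨N + 1, by omega, h.symm⟩
      · exact ⟨N + 2, by omega, h.symm⟩
      · exact ⟨i, by omega, h⟩
  obtain ⟨s0, hs0, hmax⟩ := Set.exists_max_image S
    (fun s => det2 (Q.verts (N + 2) - Q.verts (N + 1)) (s - Q.verts (N + 1))) hSf hSn
  have tailQ := tail Q N hn
  set A := Q.verts N with hAdef
  set P := Q.verts (N + 1) with hPdef
  set R := Q.verts (N + 2) with hRdef
  set B := Q.verts 0 with hBdef
  set a := det2 (R - P) (A - P) with ha
  set b := det2 (R - P) (B - P) with hb
  set μ := max (det2 (R - P) (s0 - P)) (max a b) with hμ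
  have hμ0 : μ ≤ 0 := max_le (c3 _ (h.sub hs0)) (max_le fA.le fB.le)
  have hab : max a b ≤ μ := le_max_right _ _
  have haμ : a ≤ μ := (le_max_left _ _).trans hab
  have hbμ : b ≤ μ := (le_max_right _ _).trans hab
  have hSμ : ∀ s ∈ S, det2 (R - P) (s - P) ≤ μ := fun s hs => (hmax s hs).trans (le_max_left _ _)
  obtain ⟨τ, hτ⟩ : ∃ τ, μ / a = τ := ⟨_, rfl⟩
  obtain ⟨σ, hσ⟩ : ∃ σ, μ / b = σ := ⟨_, rfl⟩
  have τ0 : 0 ≤ τ := by rw [← hτ]; exact div_nonneg_of_nonpos hμ0 fA.le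
  have τ1 : τ ≤ 1 := by rw [← hτ, div_le_one_of_neg fA]; exact haμ
  have σ0 : 0 ≤ σ := by rw [← hσ]; exact div_nonneg_of_nonpos hμ0 fB.le
  have σ1 : σ ≤ 1 := by rw [← hσ, div_le_one_of_neg fB]; exact hbμ
  have τa : τ * a = μ := by rw [← hτ, div_mul_cancel₀ _ fA.ne]
  have σb : σ * b = μ := by rw [← hσ, div_mul_cancel₀ _ fB.ne]
  obtain ⟨p, hp⟩ : ∃ p, p = P + τ • (A - P) := ⟨_, rfl⟩
  obtain ⟨q, hq⟩ : ∃ q, q = R + σ • (B - R) := ⟨_, rfl⟩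
  have hpb : p ∈ Q.body := by
    have : p = (1 - τ) • P + τ • A := by rw [hp]; module
    rw [this]; exact Q.body_convex mP mA (by linarith) τ0 (by ring)
  have hqb : q ∈ Q.body := by
    have : q = (1 - σ) • R + σ • B := by rw [hq]; module
    rw [this]; exact Q.body_convex mR mB (by linarith) σ0 (by ring)
  have fp : det2 (R - P) (p - P) = μ := by
    rw [hp, add_sub_cancel_left, det2_smul_right]; exact τa
  have fq : det2 (R - P) (q - P) = μ := by
    have : det2 (R - P) (q - P) = σ * b := by
      rw [hq, hb]
      simp only [det2, Prod.fst_sub, Prod.snd_sub, Prod.fst_add, Prod.snd_add, Prod.smul_fst,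
        Prod.smul_snd, smul_eq_mul]
      ring
    rw [this]; exact σb
  have slice : ∀ z ∈ Q.body, det2 (R - P) (z - P) = μ → z ∈ segment ℝ p q := by
    intro z hz hf
    obtain ⟨s, r, e1, e2, hs, hr, -, -⟩ := between fA fB hd1 hd2 hf (c1 z hz) (c2 z hz)
    rw [← ha, hτ, ← hp] at e1
    rw [← hb, hσ, ← hq] at e2
    exact mem_segment_of_between hs hr e1 e2
  obtain ⟨ρ, hρ0, hρ⟩ : ∃ ρ : ℝ, 0 ≤ ρ ∧ q - p = ρ • (R - P) := by
    obtain ⟨s, r, e1, e2, hs, hr, -, -⟩ := between fA fB hd1 hd2 fq (c1 q hqb) (c2 q hqb)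
    rw [← ha, hτ, ← hp] at e1
    refine ⟨s, hs, ?_⟩
    conv_lhs => rw [e1]
    abel
  have epA : p - A = (1 - τ) • (P - A) := by rw [hp]; module
  have eBq : B - q = (1 - σ) • (B - R) := by rw [hq]; module
  have ybody : ∀ y, (∃ j ≤ N, y = Q.verts j) ∨ y = p ∨ y = q → y ∈ Q.body := by
    rintro y (⟨j, _, rfl⟩ | rfl | rfl)
    · exact Q.vert_mem j
    · exact hpb
    · exact hqb
  obtain ⟨Q', hb1, hb2, hb3, hb4⟩ := tailQ p q hpb hqb
    (by
      intro j hj hjp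
      rcases Nat.lt_or_ge j N with h1 | h1
      · exfalso
        have := s1 j h1
        rw [hjp, epA, det2_smul_right, det2_self] at this
        simp at this
      · rw [← hjp, show j = N by omega])
    (by
      intro j hj hjq
      rcases Nat.eq_zero_or_pos j with h1 | h1
      · rw [← hjq, h1]
      · exfalso
        have := s2 j hj h1
        rw [hjq, hq, add_sub_cancel_left, det2_smul_right, det2_self] at this
        simp at this)
    (by
      intro y hy
      rw [epA, det2_smul_left]
      have := c1 y (ybody y hy)
      nlinarith)
    (by
      intro y hy
      rw [hρ, det2_smul_left]
      have hy' : det2 (R - P) (y - P) ≤ μ := by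
        rcases hy with ⟨j, hj, rfl⟩ | rfl | rfl
        · exact (lev j hj).trans hab
        · exact fp.le
        · exact fq.le
      have : det2 (R - P) (y - p) = det2 (R - P) (y - P) - μ := by
        rw [← fp]; simp only [det2, Prod.fst_sub, Prod.snd_sub]; ring
      rw [this]
      nlinarith)
    (by
      intro y hy
      rw [eBq, det2_smul_left]
      have h1 := c2 y (ybody y hy)
      have : det2 (B - R) (y - q) = det2 (B - R) (y - R) := by
        rw [hq]
        simp only [det2, Prod.fst_sub, Prod.snd_sub, Prod.fst_add, Prod.snd_add, Prod.smul_fst,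
          Prod.smul_snd, smul_eq_mul]
        ring
      rw [this]
      nlinarith)
  refine ⟨Q', ⟨?_, ?_, ?_⟩, ?_⟩
  · apply hb3 (fun x y => Par (y - x))
    · intro i _; exact h.par i
    · rw [epA]; exact hPar _ _ pA
    · rw [hρ]; exact hPar _ _ pP
    · rw [eBq]; exact hPar _ _ pR
  · intro z hz
    have hzb := h.sub hz
    have hzμ := hSμ z hz
    rw [bodyEq, convexHull_union (s := {P, R}) (t := Q.verts '' Set.Iic N) ⟨P, by simp⟩
      ⟨B, 0, by simp, rfl⟩, convexHull_pair,
      mem_convexJoin] at hzb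
    obtain ⟨x, hx, y, hy, hzxy⟩ := hzb
    have hxb : x ∈ Q.body := Q.body_convex.segment_subset mP mR hx
    have hyb : y ∈ Q.body := by
      rw [bodyEq]; exact convexHull_mono Set.subset_union_right hy
    have fy : det2 (R - P) (y - P) ≤ max a b := by
      have hlin : Convex ℝ {y : ℝ × ℝ | det2 (R - P) (y - P) ≤ max a b} := by
        intro u hu v hv s t hs ht hst
        simp only [Set.mem_ofPred_eq] at *
        have e : s • u + t • v - P = s • (u - P) + t • (v - P) := by
          have : P = (s + t) • P := by rw [hst, one_smul]
          conv_lhs => rw [this]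
          module
        rw [e, det2_add_right, det2_smul_right, det2_smul_right]
        calc s * det2 (R - P) (u - P) + t * det2 (R - P) (v - P)
            ≤ s * max a b + t * max a b := by gcongr
          _ = max a b := by rw [← add_mul, hst, one_mul]
      refine convexHull_min ?_ hlin hy
      rintro _ ⟨j, hj, rfl⟩
      exact lev j hj
    have fx : det2 (R - P) (x - P) = 0 := by
      obtain ⟨s, t, _, _, hst, rfl⟩ := hx
      have : s • P + t • R - P = t • (R - P) := by
        have : s = 1 - t := by linarith
        rw [this]; module
      rw [this, det2_smul_right, det2_self, mul_zero]
    have fy0 : det2 (R - P) (y - P) < 0 := lt_of_le_of_lt fy (max_lt fA fB)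
    set φ := det2 (R - P) (y - P) with hφ
    obtain ⟨s, t, hs, ht, hst, rfl⟩ := hzxy
    have ez : s • x + t • y = x + t • (y - x) := by
      have : s = 1 - t := by linarith
      rw [this]; module
    have fz : ∀ t : ℝ, det2 (R - P) (x + t • (y - x) - P) = t * φ := by
      intro t
      have : x + t • (y - x) - P = (1 - t) • (x - P) + t • (y - P) := by module
      rw [this, det2_add_right, det2_smul_right, det2_smul_right, fx]; ring
    rw [ez] at hzμ ⊢
    rw [fz] at hzμ
    have k0 : 0 ≤ μ / φ := div_nonneg_of_nonpos hμ0 fy0.le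
    have k1 : μ / φ ≤ 1 := by rw [div_le_one_of_neg fy0]; exact fy.trans hab
    have k2 : μ / φ ≤ t := by rw [div_le_iff_of_neg fy0]; exact hzμ
    have hz' : x + (μ / φ) • (y - x) ∈ segment ℝ p q := by
      apply slice
      · have : x + (μ / φ) • (y - x) = (1 - μ / φ) • x + (μ / φ) • y := by module
        rw [this]
        exact Q.body_convex hxb hyb (by linarith) k0 (by ring)
      · rw [fz, div_mul_cancel₀ _ fy0.ne]
    rw [hb1]
    have g1 : x + (μ / φ) • (y - x) ∈ convexHull ℝ (Q.verts '' Set.Iic N ∪ {p, q}) := by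
      rw [← convexHull_pair] at hz'
      exact convexHull_mono Set.subset_union_right hz'
    have g2 : y ∈ convexHull ℝ (Q.verts '' Set.Iic N ∪ {p, q}) :=
      convexHull_mono Set.subset_union_left hy
    refine (convex_convexHull ℝ _).segment_subset g1 g2
      (mem_segment_of_between (d := y - x) (s := t - μ / φ) (r := 1 - t)
        (by linarith) (by linarith) ?_ ?_)
    · module
    · module
  · refine le_trans ?_ h.per
    rw [perEq]
    have := hb2 (fun x y => L (y - x)) (fun x => by simp [hL.zero])
    unfold perimL
    rw [this, epA, eBq, hL.hom _ _ (by linarith), hL.hom _ _ (by linarith)]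
    have e : q - p = (R - P) + (τ • (P - A) + σ • (B - R)) := by rw [hp, hq]; module
    have i1 := hL.sub (R - P) (τ • (P - A) + σ • (B - R))
    have i2 := hL.sub (τ • (P - A)) (σ • (B - R))
    rw [hL.hom _ _ τ0, hL.hom _ _ σ0] at i2
    rw [e]
    linarith
  · refine hb4.imp_right ?_
    rintro ⟨hn', hpA, hqB, hg⟩
    refine ⟨hn', ?_⟩
    have hμa : a ≠ μ := by
      intro hc
      apply hpA
      have : τ = 1 := by rw [← hτ, ← hc, div_self fA.ne]
      rw [hp, this]; module
    have hμb : b ≠ μ := by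
      intro hc
      apply hqB
      have : σ = 1 := by rw [← hσ, ← hc, div_self fB.ne]
      rw [hq, this]; module
    have hfs : det2 (R - P) (s0 - P) = μ := by
      rcases max_choice (det2 (R - P) (s0 - P)) (max a b) with h1 | h1
      · rw [hμ, h1]
      · rcases max_choice a b with h2 | h2
        · exact absurd (by rw [hμ, h1, h2]) hμa
        · exact absurd (by rw [hμ, h1, h2]) hμb
    have hin := slice s0 (h.sub hs0) hfs
    have hb0 : badg S p q = 0 := by
      unfold badg; exact if_pos ⟨s0, hs0, hin⟩
    have hb1' : badg S P R = 1 := by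
      unfold badg; exact if_neg hbad
    have hbA : badg S A p ≤ badg S A P := by
      apply badg_mono
      intro s hs hseg
      obtain ⟨x, t, hx, ht, hxt, rfl⟩ := hseg
      have hf := hSμ _ hs
      have e1 : x • A + t • P - P = x • (A - P) := by
        have : t = 1 - x := by linarith
        rw [this]; module
      rw [e1, det2_smul_right, ← ha, ← τa] at hf
      have hxτ : τ ≤ x := by
        by_contra hc; push Not at hc
        nlinarith
      have hx' : x = 1 - t := by linarith
      refine mem_segment_of_between (d := P - A) (s := t) (r := 1 - τ - t) ht (by linarith) ?_ ?_
      · rw [hx']; module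
      · rw [hx', hp]; module
    have hbB : badg S q B ≤ badg S R B := by
      apply badg_mono
      intro s hs hseg
      obtain ⟨x, t, hx, ht, hxt, rfl⟩ := hseg
      have hf := hSμ _ hs
      have hx' : x = 1 - t := by linarith
      have e1 : det2 (R - P) (x • R + t • B - P) = t * b := by
        rw [hx', hb]
        simp only [det2, Prod.fst_sub, Prod.snd_sub, Prod.fst_add, Prod.snd_add, Prod.smul_fst,
          Prod.smul_snd, smul_eq_mul]
        ring
      rw [e1, ← σb] at hf
      have hxσ : σ ≤ t := by
        by_contra hc; push Not at hc
        nlinarith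
      refine mem_segment_of_between (d := B - R) (s := t - σ) (r := 1 - t)
        (by linarith) (by linarith) ?_ ?_
      · rw [hx', hq]; module
      · rw [hx']; module
    have := hg (badg S)
    unfold badc at badEq ⊢
    rw [this, badEq, hb0, hb1']
    omega

lemma exists_min_nat {α : Type} (p : α → Prop) (f : α → ℕ) (h : ∃ a, p a) :
    ∃ a, p a ∧ ∀ b, p b → f a ≤ f b := by
  classical
  have h' : ∃ n, ∃ a, p a ∧ f a = n := by
    obtain ⟨a, ha⟩ := h; exact ⟨f a, a, ha, rfl⟩
  obtain ⟨a, ha, hfa⟩ := Nat.find_spec h'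
  refine ⟨a, ha, fun b hb => ?_⟩
  rw [hfa]; exact Nat.find_min' h' ⟨b, hb, rfl⟩

lemma seg_poly (x y : ℝ × ℝ) (hxny : x ≠ y) : ∃ Q' : ClockPolygon, x ∈ Q'.body ∧ y ∈ Q'.body ∧
    (∀ g : ℝ × ℝ → ℝ × ℝ → ℝ, ∑ i ∈ Finset.range Q'.n, g (Q'.verts i) (Q'.verts (i + 1))
      = g x y + g y x) ∧
    (∀ R : ℝ × ℝ → ℝ × ℝ → Prop, R x y → R y x → ∀ i, R (Q'.verts i) (Q'.verts (i + 1))) := by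
  have cases01 : ∀ j ≤ 1, (if j = 0 then x else y) = x ∨
      (if j = 0 then x else y) = y := by
    intro j _
    by_cases h0 : j = 0 <;> simp [h0]
  obtain ⟨Q', h1, h2, h3, h4, -⟩ := exists_poly 1 (fun k => if k = 0 then x else y)
    (by
      intro i j hi hj hij
      have hi' : i = 0 ∨ i = 1 := by omega
      have hj' : j = 0 ∨ j = 1 := by omega
      rcases hi' with rfl | rfl <;> rcases hj' with rfl | rfl
      · rfl
      · exact absurd (by simpa using hij) hxny
      · exact absurd (by simpa using hij.symm) hxny
      · rfl)
    (by
      intro i hi j hj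
      have : i = 0 := by omega
      subst this
      rcases cases01 j hj with e | e <;> rw [e] <;>
        simp only [det2, Prod.fst_sub, Prod.snd_sub, zero_add, one_ne_zero, if_true, if_false] <;>
        apply le_of_eq <;> ring)
    (by
      intro j hj
      rcases cases01 j hj with e | e <;> rw [e] <;>
        simp only [det2, Prod.fst_sub, Prod.snd_sub, one_ne_zero, if_true, if_false] <;>
        apply le_of_eq <;> ring)
  refine ⟨Q', ?_, ?_, ?_, ?_⟩
  · rw [h2]
    exact subset_convexHull ℝ _ ⟨0, by simp, by simp⟩
  · rw [h2]
    exact subset_convexHull ℝ _ ⟨1, by simp, by simp⟩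
  · intro g
    rw [h3 ℝ g]
    simp
  · intro R r1 r2
    apply h4 R
    · intro i hi
      have : i = 0 := by omega
      subst this
      simpa using r1
    · simpa using r2

lemma degen_case {L : ℝ × ℝ → ℝ} {Par : ℝ × ℝ → Prop} {S : Set (ℝ × ℝ)} {c : ℝ}
    {Q : ClockPolygon} (hL : Sublin L) (hPar : ∀ (t : ℝ) v, Par v → Par (t • v))
    (hSf : S.Finite) (hSn : S.Nonempty)
    (h : Fam L Par S c Q) (hdeg : Degen Q) :
    ∃ Q' : ClockPolygon, Fam L Par S c Q' ∧ ∀ i, Q'.verts i ∈ S := by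
  obtain ⟨w, u, hu, hline⟩ := hdeg
  have huu : dot2 u u ≠ 0 := by
    intro h0
    apply hu
    simp only [dot2] at h0
    have h1 : u.1 = 0 := by nlinarith [mul_self_nonneg u.1, mul_self_nonneg u.2]
    have h2 : u.2 = 0 := by nlinarith [mul_self_nonneg u.1, mul_self_nonneg u.2]
    exact Prod.ext h1 h2
  obtain ⟨T, hT⟩ : ∃ T : ℝ × ℝ → ℝ, ∀ y, T y = dot2 u (y - w) / dot2 u u := ⟨_, fun _ => rfl⟩
  have Taff : ∀ (s t : ℝ) (a b : ℝ × ℝ), s + t = 1 → T (s • a + t • b) = s * T a + t * T b := by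
    intro s t a b hst
    have : s = 1 - t := by linarith
    rw [hT, hT, hT, this]
    field_simp
    simp only [dot2, Prod.fst_sub, Prod.snd_sub, Prod.fst_add, Prod.snd_add, Prod.smul_fst,
      Prod.smul_snd, smul_eq_mul]
    ring
  have Trep : ∀ y ∈ Q.body, y = w + T y • u := by
    intro y hy
    have h0 : det2 u (y - w) = 0 := by
      have hconv : Convex ℝ {y : ℝ × ℝ | det2 u (y - w) = 0} := by
        intro a ha b hb s t hs ht hst
        simp only [Set.mem_ofPred_eq] at *
        have e : s • a + t • b - w = s • (a - w) + t • (b - w) := by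
          have : s = 1 - t := by linarith
          rw [this]; module
        rw [e, det2_add_right, det2_smul_right, det2_smul_right, ha, hb]; ring
      refine convexHull_min ?_ hconv hy
      rintro _ ⟨k, rfl⟩
      exact hline k
    obtain ⟨r, hr⟩ := exists_smul_of_det2_eq_zero hu h0
    have : T y = r := by
      rw [hT, hr, div_eq_iff huu]
      simp only [dot2, Prod.smul_fst, Prod.smul_snd, smul_eq_mul]; ring
    rw [this, ← hr]; abel
  obtain ⟨x, hx, hxm⟩ := Set.exists_min_image S T hSf hSn
  obtain ⟨y, hy, hym⟩ := Set.exists_max_image S T hSf hSn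
  have par0 : Par 0 := by
    have := hPar 0 _ (h.par 0); rwa [zero_smul] at this
  have pernn : 0 ≤ c := le_trans (Finset.sum_nonneg fun i _ => hL.nonneg _) h.per
  rcases eq_or_lt_of_le (hxm y hy) with hxy | hxy
  · obtain ⟨Q', h1, h2, h3, h4, -⟩ := exists_poly 0 (fun _ => x) (by intros; omega)
      (by intros; omega) (by intros; simp [det2])
    refine ⟨Q', ⟨?_, ?_, ?_⟩, ?_⟩
    · exact h4 (fun p q => Par (q - p)) (by intros; omega) (by simpa using par0)
    · intro s hs
      have e1 := hxm s hs
      have e2 := hym s hs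
      have : s = x := by
        rw [Trep s (h.sub hs), Trep x (h.sub hx)]
        congr 2; linarith
      rw [h2, this]
      exact subset_convexHull ℝ _ ⟨0, by simp, rfl⟩
    · unfold perimL
      rw [h3 ℝ (fun p q => L (q - p))]
      simp [hL.zero, pernn]
    · exact h4 (fun p _ => p ∈ S) (by intros; omega) hx
  · -- a genuine segment
    obtain ⟨j, hj⟩ : ∃ j, T (Q.verts j) ≤ T x := by
      by_contra hc
      push Not at hc
      have hconv : Convex ℝ {z : ℝ × ℝ | T x < T z} := by
        intro a ha b hb s t hs ht hst
        simp only [Set.mem_ofPred_eq] at *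
        rw [Taff s t a b hst]
        rcases eq_or_lt_of_le hs with h0 | h0
        · have : t = 1 := by linarith
          rw [← h0, this]; linarith
        · have e : T x = s * T x + t * T x := by rw [← add_mul, hst, one_mul]
          nlinarith [mul_lt_mul_of_pos_left ha h0, mul_le_mul_of_nonneg_left hb.le ht]
      have : x ∈ {z : ℝ × ℝ | T x < T z} := by
        refine convexHull_min ?_ hconv (h.sub hx)
        rintro _ ⟨k, rfl⟩
        exact hc k
      rw [Set.mem_ofPred_eq] at this
      exact lt_irrefl _ this
    obtain ⟨k, hk⟩ : ∃ k, T y ≤ T (Q.verts k) := by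
      by_contra hc
      push Not at hc
      have hconv : Convex ℝ {z : ℝ × ℝ | T z < T y} := by
        intro a ha b hb s t hs ht hst
        simp only [Set.mem_ofPred_eq] at *
        rw [Taff s t a b hst]
        rcases eq_or_lt_of_le hs with h0 | h0
        · have : t = 1 := by linarith
          rw [← h0, this]; linarith
        · have e : T y = s * T y + t * T y := by rw [← add_mul, hst, one_mul]
          nlinarith [mul_lt_mul_of_pos_left ha h0, mul_le_mul_of_nonneg_left hb.le ht]
      have : y ∈ {z : ℝ × ℝ | T z < T y} := by
        refine convexHull_min ?_ hconv (h.sub hy)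
        rintro _ ⟨k, rfl⟩
        exact hc k
      rw [Set.mem_ofPred_eq] at this
      exact lt_irrefl _ this
    set P := Q.rot j with hP
    have hPf := h.rot j
    rw [← hP] at hPf
    have hv0 : P.verts 0 = Q.verts j := by rw [hP, Q.rot_verts, zero_add]
    obtain ⟨l, hl, hvl⟩ : ∃ l < P.n, P.verts l = Q.verts k := by
      have : Q.verts k ∈ Set.range P.verts := by
        have h1 := Q.range_rot j
        have h2 : Set.range P.verts = Set.range (fun i => Q.verts (i + j)) := rfl
        rw [h2, h1]; exact ⟨k, rfl⟩
      rw [P.range_eq_image] at this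
      obtain ⟨l, hl, e⟩ := this
      exact ⟨l, hl, e⟩
    obtain ⟨D, hD⟩ : ∃ D, D = T (Q.verts k) - T (Q.verts j) := ⟨_, rfl⟩
    have hD1 : T y - T x ≤ D := by linarith
    have ed1 : Q.verts k - Q.verts j = D • u := by
      rw [Trep _ (Q.vert_mem k), Trep _ (Q.vert_mem j), hD]; module
    have ed2 : Q.verts j - Q.verts k = D • (-u) := by
      rw [← neg_sub, ed1, smul_neg]
    have i1 := path_le hL P.verts 0 l
    have i2 := path_le hL P.verts l (P.n - l)
    rw [zero_add, hvl, hv0, ed1, hL.hom _ _ (by linarith)] at i1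
    have hPn0 : P.verts (l + (P.n - l)) = P.verts 0 := by
      rw [Nat.add_sub_cancel' hl.le]
      have := P.periodic 0
      rwa [zero_add] at this
    rw [hPn0, hvl, hv0, ed2, hL.hom _ _ (by linarith)] at i2
    have hsum : perimL L P = ∑ i ∈ Finset.range l, L (P.verts (0 + i + 1) - P.verts (0 + i)) +
        ∑ i ∈ Finset.range (P.n - l), L (P.verts (l + i + 1) - P.verts (l + i)) := by
      unfold perimL
      conv_lhs => rw [← Nat.add_sub_cancel' hl.le]
      rw [Finset.sum_range_add]
      simp
    have hper := hPf.per
    have eyx : y - x = (T y - T x) • u := by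
      conv_lhs => rw [Trep y (h.sub hy), Trep x (h.sub hx)]
      module
    have exy : x - y = (T y - T x) • (-u) := by
      rw [← neg_sub, eyx, smul_neg]
    have hxny : x ≠ y := by rintro rfl; exact lt_irrefl _ hxy
    have hDpos : 0 < D := by linarith
    have hn2 : 2 ≤ Q.n := by
      by_contra hlt
      have := Q.npos
      have h1' : Q.n = 1 := by omega
      have e0 : Q.verts k = Q.verts j := by rw [Q.verts_eq_iff, h1']; omega
      rw [e0, sub_self] at hD; linarith
    have paru : Par u := by
      have e1 : Q.verts (0 + 1) - Q.verts 0 = (T (Q.verts (0 + 1)) - T (Q.verts 0)) • u := by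
        conv_lhs => rw [Trep _ (Q.vert_mem (0 + 1)), Trep _ (Q.vert_mem 0)]
        module
      have hne : T (Q.verts (0 + 1)) - T (Q.verts 0) ≠ 0 := by
        intro h0
        rw [h0, zero_smul] at e1
        exact Q.edge_ne hn2 0 (sub_eq_zero.1 e1)
      have := hPar (T (Q.verts (0 + 1)) - T (Q.verts 0))⁻¹ _ (h.par 0)
      rwa [e1, smul_smul, inv_mul_cancel₀ hne, one_smul] at this
    obtain ⟨Q', mx, my, h3, h4⟩ := seg_poly x y hxny
    refine ⟨Q', ⟨?_, ?_, ?_⟩, ?_⟩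
    · apply h4 (fun p q => Par (q - p))
      · rw [eyx]; exact hPar _ _ paru
      · rw [exy, smul_neg, ← neg_smul]; exact hPar _ _ paru
    · intro s hs
      have e1 := hxm s hs
      have e2 := hym s hs
      refine Q'.body_convex.segment_subset mx my
        (mem_segment_of_between (d := u) (s := T s - T x) (r := T y - T s)
          (by linarith) (by linarith) ?_ ?_)
      · conv_lhs => rw [Trep s (h.sub hs)]
        conv_rhs => rw [Trep x (h.sub hx)]
        have : T (w + T x • u) = T x := by rw [← Trep x (h.sub hx)]
        rw [this]; module
      · conv_lhs => rw [Trep y (h.sub hy)]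
        conv_rhs => rw [Trep s (h.sub hs)]
        have : T (w + T s • u) = T s := by rw [← Trep s (h.sub hs)]
        rw [this]; module
    · unfold perimL
      rw [h3 (fun p q => L (q - p))]
      rw [eyx, exy, hL.hom _ _ (by linarith), hL.hom _ _ (by linarith)]
      have n1 := hL.nonneg u
      have n2 := hL.nonneg (-u)
      nlinarith
    · exact h4 (fun p _ => p ∈ S) hx hy

lemma reduce {L : ℝ × ℝ → ℝ} {Par : ℝ × ℝ → Prop} {S : Set (ℝ × ℝ)} {c : ℝ}
    {Q : ClockPolygon} (hL : Sublin L) (hPar : ∀ (t : ℝ) v, Par v → Par (t • v))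
    (hSf : S.Finite) (hSn : S.Nonempty) (h : Fam L Par S c Q) :
    ∃ X : ClockPolygon, Fam L Par S c X ∧
      (∀ i, ∃ s ∈ S, s ∈ segment ℝ (X.verts i) (X.verts (i + 1))) ∧
      (∀ i, X.verts (i + 1) ∈ S ∨
        det2 (X.verts (i + 1) - X.verts i) (X.verts (i + 1 + 1) - X.verts (i + 1)) ≠ 0) := by
  obtain ⟨Q1, hQ1, hmin1⟩ := exists_min_nat (Fam L Par S c) ClockPolygon.n ⟨Q, h⟩
  obtain ⟨X, ⟨hX, hXn⟩, hmin2⟩ := exists_min_nat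
    (fun X => Fam L Par S c X ∧ X.n = Q1.n) (badc S) ⟨Q1, hQ1, rfl⟩
  by_cases hdeg : Degen X
  · obtain ⟨Q', hf, hv⟩ := degen_case hL hPar hSf hSn hX hdeg
    exact ⟨Q', hf, fun i => ⟨_, hv i, left_mem_segment ℝ _ _⟩, fun i => Or.inl (hv _)⟩
  have hstr : Strong X := strong_of_min hL hPar hX (by rw [hXn]; exact hmin1) hdeg
  have hn3 : 3 ≤ X.n := by
    by_contra hlt
    apply hdeg
    have := X.npos
    have hc : X.n = 1 ∨ X.n = 2 := by omega
    rcases hc with h1 | h2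
    · refine ⟨X.verts 0, (1, 0), by simp, fun k => ?_⟩
      have : X.verts k = X.verts 0 := by rw [X.verts_eq_iff, h1]; omega
      rw [this, sub_self]; simp [det2]
    · refine ⟨X.verts 0, X.verts (0 + 1) - X.verts 0,
        sub_ne_zero.2 (X.edge_ne (by omega) 0), fun k => ?_⟩
      have hk : k % 2 = 0 ∨ k % 2 = 1 := by omega
      rcases hk with hk | hk
      · have : X.verts k = X.verts 0 := by rw [X.verts_eq_iff, h2]; omega
        rw [this, sub_self]; simp [det2]
      · have : X.verts k = X.verts (0 + 1) := by rw [X.verts_eq_iff, h2]; omega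
        rw [this, det2_self]
  refine ⟨X, hX, ?_, ?_⟩
  · intro i
    by_contra hbad
    obtain ⟨N, hN⟩ : ∃ N, X.n = N + 3 := ⟨X.n - 3, by omega⟩
    have e1 : (X.rot (i + 2)).verts (N + 1) = X.verts i := by
      rw [X.rot_verts, show N + 1 + (i + 2) = i + X.n by omega, X.periodic]
    have e2 : (X.rot (i + 2)).verts (N + 2) = X.verts (i + 1) := by
      rw [X.rot_verts, show N + 2 + (i + 2) = i + 1 + X.n by omega, X.periodic]
    obtain ⟨Q', hf, hor⟩ := push hL hPar hSf hSn (hX.rot (i + 2)) (hstr.rot (i + 2)) N hN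
      (by rw [e1, e2]; exact hbad)
    have hb : badc S (X.rot (i + 2)) = badc S X := X.rot_sum (i + 2) (badg S)
    rw [hb, X.rot_n] at hor
    rcases hor with h1 | ⟨h1, h2⟩
    · have := hmin1 Q' hf
      omega
    · have := hmin2 Q' ⟨hf, by omega⟩
      omega
  · intro i
    right
    have hne1 : X.verts (i + 1 + 1) ≠ X.verts i := by
      intro hc
      rw [X.verts_eq_iff] at hc
      have h1 : (2 + i) ≡ (0 + i) [MOD X.n] := by
        rw [add_comm 2 i, zero_add]; exact hc
      have h2 : 2 % X.n = 0 % X.n := Nat.ModEq.add_right_cancel' i h1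
      rw [Nat.mod_eq_of_lt (by omega), Nat.zero_mod] at h2
      omega
    have := hstr i (i + 1 + 1) hne1 (X.edge_ne (by omega) (i + 1))
    have e : det2 (X.verts (i + 1) - X.verts i) (X.verts (i + 1 + 1) - X.verts (i + 1)) =
        det2 (X.verts (i + 1) - X.verts i) (X.verts (i + 1 + 1) - X.verts i) := by
      simp only [det2, Prod.fst_sub, Prod.snd_sub]; ring
    rw [e]; exact this.ne

/-- the integers inside the reals -/
abbrev ZR : Subring ℝ := (Int.castRingHom ℝ).range

lemma mem_ZR {x : ℝ} : x ∈ ZR ↔ ∃ m : ℤ, x = m := by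
  constructor
  · rintro ⟨m, rfl⟩; exact ⟨m, by simp⟩
  · rintro ⟨m, rfl⟩; exact ⟨m, by simp⟩

lemma lattice_iff (p : ℝ × ℝ) : IsLatticePt p ↔ p.1 ∈ ZR ∧ p.2 ∈ ZR := by
  rw [mem_ZR, mem_ZR]; rfl

lemma nat_ZR (n : ℕ) : (n : ℝ) ∈ ZR := mem_ZR.2 ⟨n, by simp⟩

lemma det2_ZR {p q : ℝ × ℝ} (hp : IsLatticePt p) (hq : IsLatticePt q) : det2 p q ∈ ZR := by
  rw [lattice_iff] at hp hq
  exact ZR.sub_mem (ZR.mul_mem hp.1 hq.2) (ZR.mul_mem hp.2 hq.1)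

lemma common_denom {ι : Type} (s : Finset ι) (f : ι → ℝ) (hf : ∀ i ∈ s, ∃ q : ℚ, f i = q) :
    ∃ D : ℕ, 0 < D ∧ ∀ i ∈ s, (D : ℝ) * f i ∈ ZR := by
  classical
  induction s using Finset.induction_on with
  | empty => exact ⟨1, one_pos, by simp⟩
  | insert a s ha ih =>
    obtain ⟨D, hD, h⟩ := ih (fun i hi => hf i (Finset.mem_insert_of_mem hi))
    obtain ⟨q, hq⟩ := hf a (Finset.mem_insert_self _ _)
    refine ⟨D * q.den, Nat.mul_pos hD q.den_pos, fun i hi => ?_⟩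
    rcases Finset.mem_insert.1 hi with rfl | hi
    · have : ((D * q.den : ℕ) : ℝ) * f i = D * ((q.num : ℤ) : ℝ) := by
        rw [hq]; push_cast
        have h2 : (q : ℝ) * (q.den : ℝ) = (q.num : ℝ) := by
          exact_mod_cast congrArg (fun z : ℚ => (z : ℝ)) (Rat.mul_den_eq_num q)
        rw [← h2]; ring
      rw [this]
      exact ZR.mul_mem (nat_ZR _) (mem_ZR.2 ⟨_, rfl⟩)
    · have : ((D * q.den : ℕ) : ℝ) * f i = q.den * (D * f i) := by push_cast; ring
      rw [this]
      exact ZR.mul_mem (nat_ZR _) (h i hi)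

lemma omegaLen_spec (P : ClockPolygon) (v : ℝ × ℝ) :
    (∃ j, omegaLen P.body v = det2 v (P.verts j)) ∧
      ∀ q ∈ P.body, det2 v q ≤ omegaLen P.body v := by
  obtain ⟨j, -, hj⟩ := Finset.exists_max_image (Finset.range P.n)
    (fun j => det2 v (P.verts j)) ⟨0, Finset.mem_range.2 P.npos⟩
  have hmax : ∀ q ∈ P.body, det2 v q ≤ det2 v (P.verts j) := by
    intro q hq
    have hconv : Convex ℝ {z : ℝ × ℝ | det2 v z ≤ det2 v (P.verts j)} := by
      intro a ha b hb s t hs ht hst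
      simp only [Set.mem_ofPred_eq] at *
      rw [det2_add_right, det2_smul_right, det2_smul_right]
      have e : det2 v (P.verts j) = s * det2 v (P.verts j) + t * det2 v (P.verts j) := by
        rw [← add_mul, hst, one_mul]
      rw [e]
      exact add_le_add (mul_le_mul_of_nonneg_left ha hs) (mul_le_mul_of_nonneg_left hb ht)
    have : q ∈ {z : ℝ × ℝ | det2 v z ≤ det2 v (P.verts j)} := by
      refine convexHull_min ?_ hconv hq
      rintro _ ⟨k, rfl⟩
      have := hj (k % P.n) (Finset.mem_range.2 (Nat.mod_lt _ P.npos))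
      rw [P.verts_mod] at this
      exact this
    exact this
  have hg : IsGreatest (det2 v '' P.body) (det2 v (P.verts j)) := by
    refine ⟨⟨_, P.vert_mem j, rfl⟩, ?_⟩
    rintro _ ⟨q, hq, rfl⟩
    exact hmax q hq
  have e : omegaLen P.body v = det2 v (P.verts j) := hg.csSup_eq
  exact ⟨⟨j, e⟩, fun q hq => by rw [e]; exact hmax q hq⟩

lemma det2_add_left (u v p : ℝ × ℝ) : det2 (u + v) p = det2 u p + det2 v p := by
  simp only [det2, Prod.fst_add, Prod.snd_add]; ring

lemma sublin_omega (P : ClockPolygon) (h0 : (((0 : ℝ), (0 : ℝ)) ∈ P.body)) :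
    Sublin (omegaLen P.body) where
  sub u v := by
    obtain ⟨⟨j, hj⟩, -⟩ := omegaLen_spec P (u + v)
    rw [hj, det2_add_left]
    exact add_le_add ((omegaLen_spec P u).2 _ (P.vert_mem j))
      ((omegaLen_spec P v).2 _ (P.vert_mem j))
  hom c v hc := by
    obtain ⟨⟨j, hj⟩, h1⟩ := omegaLen_spec P (c • v)
    obtain ⟨⟨k, hk⟩, h2⟩ := omegaLen_spec P v
    apply le_antisymm
    · rw [hj, det2_smul_left]
      exact mul_le_mul_of_nonneg_left (h2 _ (P.vert_mem j)) hc
    · have := h1 _ (P.vert_mem k)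
      rwa [det2_smul_left, ← hk] at this
  nonneg v := by
    have := (omegaLen_spec P v).2 _ h0
    simpa [det2] using this

lemma lattice_finite (Q : ClockPolygon) : {p ∈ Q.body | IsLatticePt p}.Finite := by
  obtain ⟨C, hC⟩ := Q.body_compact.isBounded.exists_norm_le
  obtain ⟨N, hN⟩ := exists_nat_ge C
  refine Set.Finite.subset (((Set.finite_Icc (-(N : ℤ)) N).prod
    (Set.finite_Icc (-(N : ℤ)) N)).image (fun z : ℤ × ℤ => ((z.1 : ℝ), (z.2 : ℝ)))) ?_
  rintro ⟨x, y⟩ ⟨hb, ⟨a, ha⟩, ⟨b, hb'⟩⟩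
  have h1 := (hC _ hb).trans hN
  have hx : |x| ≤ N := (norm_fst_le (x, y)).trans h1
  have hy : |y| ≤ N := (norm_snd_le (x, y)).trans h1
  simp only at ha hb'
  subst ha hb'
  rw [abs_le] at hx hy
  refine ⟨(a, b), ⟨⟨?_, ?_⟩, ⟨?_, ?_⟩⟩, rfl⟩
  · have := hx.1; exact_mod_cast this
  · have := hx.2; exact_mod_cast this
  · have := hy.1; exact_mod_cast this
  · have := hy.2; exact_mod_cast this

def ParTo (P : ClockPolygon) (v : ℝ × ℝ) : Prop :=
  ∃ j < P.n, ∃ t : ℝ, v = t • (P.verts (j + 1) - P.verts j)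

lemma edgesParallel_iff (Q P : ClockPolygon) :
    EdgesParallel Q P ↔ ∀ i, ParTo P (Q.verts (i + 1) - Q.verts i) := by
  constructor
  · intro h i
    by_cases h0 : Q.verts (i + 1) - Q.verts i = 0
    · exact ⟨0, P.npos, 0, by rw [h0, zero_smul]⟩
    · have e : Q.verts (i % Q.n + 1) - Q.verts (i % Q.n) = Q.verts (i + 1) - Q.verts i := by
        rw [Q.verts_mod_succ, Q.verts_mod]
      obtain ⟨j, hj, t, -, ht⟩ := h (i % Q.n) (Nat.mod_lt _ Q.npos) (by rw [e]; exact h0)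
      exact ⟨j, hj, t, by rw [← e]; exact ht⟩
  · intro h i _ hne
    obtain ⟨j, hj, t, ht⟩ := h i
    refine ⟨j, hj, t, ?_, ht⟩
    rintro rfl
    rw [zero_smul] at ht
    exact hne ht

/-- Cramer's rule, integrality version. -/
lemma cramer {E E' v : ℝ × ℝ} {D : ℝ} (hE : IsLatticePt E) (hE' : IsLatticePt E')
    (h1 : det2 E v ∈ ZR) (h2 : det2 E' v ∈ ZR) (h0 : det2 E E' ≠ 0)
    (hD : D * (det2 E E')⁻¹ ∈ ZR) : IsLatticePt (D • v) := by
  rw [lattice_iff] at *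
  constructor
  · have : (D • v).1 = (D * (det2 E E')⁻¹) * (E'.1 * det2 E v - E.1 * det2 E' v) := by
      rw [Prod.smul_fst, smul_eq_mul]
      field_simp
      simp only [det2]; ring
    rw [this]
    exact ZR.mul_mem hD (ZR.sub_mem (ZR.mul_mem hE'.1 h1) (ZR.mul_mem hE.1 h2))
  · have : (D • v).2 = (D * (det2 E E')⁻¹) * (E'.2 * det2 E v - E.2 * det2 E' v) := by
      rw [Prod.smul_snd, smul_eq_mul]
      field_simp
      simp only [det2]; ring
    rw [this]
    exact ZR.mul_mem hD (ZR.sub_mem (ZR.mul_mem hE'.2 h1) (ZR.mul_mem hE.2 h2))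

lemma exists_denoms (P : ClockPolygon) (hrat : ∀ i, IsRationalPt (P.verts i)) :
    ∃ D0 D1 : ℕ, 0 < D0 ∧ 0 < D1 ∧ (∀ j, IsLatticePt ((D0 : ℝ) • P.verts j)) ∧
      ∀ j < P.n, ∀ l < P.n, (D1 : ℝ) * (det2 ((D0 : ℝ) • (P.verts (j + 1) - P.verts j))
        ((D0 : ℝ) • (P.verts (l + 1) - P.verts l)))⁻¹ ∈ ZR := by
  obtain ⟨A, hA, hA'⟩ := common_denom (Finset.range P.n) (fun j => (P.verts j).1)
    (fun j _ => (hrat j).1)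
  obtain ⟨B, hB, hB'⟩ := common_denom (Finset.range P.n) (fun j => (P.verts j).2)
    (fun j _ => (hrat j).2)
  obtain ⟨D1, hD1, hD1'⟩ := common_denom (Finset.range P.n ×ˢ Finset.range P.n)
    (fun z => (det2 (((A * B : ℕ) : ℝ) • (P.verts (z.1 + 1) - P.verts z.1))
        (((A * B : ℕ) : ℝ) • (P.verts (z.2 + 1) - P.verts z.2)))⁻¹) (by
      rintro ⟨j, l⟩ -
      obtain ⟨⟨a, ha⟩, ⟨b, hb⟩⟩ := hrat j
      obtain ⟨⟨a1, ha1⟩, ⟨b1, hb1⟩⟩ := hrat (j + 1)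
      obtain ⟨⟨c, hc⟩, ⟨d, hd⟩⟩ := hrat l
      obtain ⟨⟨c1, hc1⟩, ⟨d1, hd1⟩⟩ := hrat (l + 1)
      refine ⟨((A * B : ℕ) * (a1 - a) * ((A * B : ℕ) * (d1 - d)) -
        (A * B : ℕ) * (b1 - b) * ((A * B : ℕ) * (c1 - c)))⁻¹, ?_⟩
      simp only [det2, Prod.smul_fst, Prod.smul_snd, smul_eq_mul, Prod.fst_sub, Prod.snd_sub,
        ha, hb, ha1, hb1, hc, hd, hc1, hd1]
      push_cast
      rfl)
  refine ⟨A * B, D1, Nat.mul_pos hA hB, hD1, fun j => ?_, fun j hj l hl =>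
    hD1' (j, l) (Finset.mem_product.2 ⟨Finset.mem_range.2 hj, Finset.mem_range.2 hl⟩)⟩
  rw [← P.verts_mod j, lattice_iff]
  have hj : j % P.n ∈ Finset.range P.n := Finset.mem_range.2 (Nat.mod_lt _ P.npos)
  constructor
  · have : (((A * B : ℕ) : ℝ) • P.verts (j % P.n)).1 = B * (A * (P.verts (j % P.n)).1) := by
      rw [Prod.smul_fst, smul_eq_mul]; push_cast; ring
    rw [this]
    exact ZR.mul_mem (nat_ZR _) (hA' _ hj)
  · have : (((A * B : ℕ) : ℝ) • P.verts (j % P.n)).2 = A * (B * (P.verts (j % P.n)).2) := by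
      rw [Prod.smul_snd, smul_eq_mul]; push_cast; ring
    rw [this]
    exact ZR.mul_mem (nat_ZR _) (hB' _ hj)

lemma lattice_sub {p q : ℝ × ℝ} (hp : IsLatticePt p) (hq : IsLatticePt q) :
    IsLatticePt (p - q) := by
  rw [lattice_iff] at *
  exact ⟨ZR.sub_mem hp.1 hq.1, ZR.sub_mem hp.2 hq.2⟩

lemma lattice_smul {p : ℝ × ℝ} (n : ℕ) (hp : IsLatticePt p) : IsLatticePt ((n : ℝ) • p) := by
  rw [lattice_iff] at *
  exact ⟨ZR.mul_mem (nat_ZR n) hp.1, ZR.mul_mem (nat_ZR n) hp.2⟩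

/-- good polygons -/
structure Good (P : ClockPolygon) (k D1 : ℕ) (X : ClockPolygon) : Prop where
  par : EdgesParallel X P
  cnt : k + 1 ≤ latticeCount X.body
  edge : ∀ i, ∃ p ∈ segment ℝ (X.verts i) (X.verts (i + 1)), IsLatticePt p
  vert : ∀ i, IsLatticePt ((D1 : ℝ) • X.verts i)

lemma exists_good (P : ClockPolygon) (h0 : (((0 : ℝ), (0 : ℝ)) ∈ P.body)) (k D0 D1 : ℕ)
    (hD0 : 0 < D0) (hlat : ∀ j, IsLatticePt ((D0 : ℝ) • P.verts j))
    (hD1 : ∀ j < P.n, ∀ l < P.n, (D1 : ℝ) * (det2 ((D0 : ℝ) • (P.verts (j + 1) - P.verts j))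
        ((D0 : ℝ) • (P.verts (l + 1) - P.verts l)))⁻¹ ∈ ZR)
    (Q : ClockPolygon) (hpar : EdgesParallel Q P) (hcnt : k + 1 ≤ latticeCount Q.body) :
    ∃ X, Good P k D1 X ∧ omegaPerim P.body X ≤ omegaPerim P.body Q := by
  have hfin := lattice_finite Q
  have hne : {p ∈ Q.body | IsLatticePt p}.Nonempty := by
    rw [Set.nonempty_iff_ne_empty]
    intro h
    unfold latticeCount at hcnt
    rw [h, Set.ncard_empty] at hcnt
    omega
  obtain ⟨X, hX, hedge, hvert⟩ := reduce (L := omegaLen P.body) (Par := ParTo P)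
    (c := omegaPerim P.body Q) (Q := Q)
    (sublin_omega P h0)
    (by
      rintro t v ⟨j, hj, s, rfl⟩
      exact ⟨j, hj, t * s, by rw [smul_smul]⟩) hfin hne
    ⟨(edgesParallel_iff Q P).1 hpar, Set.sep_subset _ _, le_rfl⟩
  have hD0' : (D0 : ℝ) ≠ 0 := by exact_mod_cast hD0.ne'
  have hsucc : ∀ i, IsLatticePt ((D1 : ℝ) • X.verts (i + 1)) := by
    intro i
    rcases hvert i with h | h
    · exact lattice_smul _ h.2
    obtain ⟨j, hj, t, ht⟩ := hX.par i
    obtain ⟨l, hl, r, hr⟩ := hX.par (i + 1)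
    obtain ⟨p, hp, hp'⟩ := hedge i
    obtain ⟨q, hq, hq'⟩ := hedge (i + 1)
    rw [segment_eq_image'] at hp' hq'
    obtain ⟨θ, -, hθ⟩ := hp'
    obtain ⟨φ, -, hφ⟩ := hq'
    simp only at hθ hφ
    have hE : ∀ j, IsLatticePt ((D0 : ℝ) • (P.verts (j + 1) - P.verts j)) := by
      intro j
      rw [smul_sub]
      exact lattice_sub (hlat _) (hlat _)
    refine cramer (hE j) (hE l) ?_ ?_ ?_ (hD1 j hj l hl)
    · have e : X.verts (i + 1) = p + ((1 - θ) * t) • (P.verts (j + 1) - P.verts j) := by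
        rw [mul_smul, ← ht, ← hθ]; module
      rw [e, det2_add_right, det2_smul_right, det2_smul_left, det2_smul_left, det2_self, mul_zero, mul_zero,
        add_zero, ← det2_smul_left]
      exact det2_ZR (hE j) hp.2
    · have e : X.verts (i + 1) = q + (-φ * r) • (P.verts (l + 1) - P.verts l) := by
        rw [mul_smul, ← hr, ← hφ]; module
      rw [e, det2_add_right, det2_smul_right, det2_smul_left, det2_smul_left, det2_self, mul_zero, mul_zero,
        add_zero, ← det2_smul_left]
      exact det2_ZR (hE l) hq.2
    · intro h3
      apply h
      rw [ht, hr, det2_smul_left, det2_smul_right]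
      rw [det2_smul_left, det2_smul_right] at h3
      have : det2 (P.verts (j + 1) - P.verts j) (P.verts (l + 1) - P.verts l) = 0 := by
        simpa [hD0'] using h3
      rw [this]; ring
  refine ⟨X, ⟨(edgesParallel_iff X P).2 hX.par, hcnt.trans ?_, ?_, ?_⟩, hX.per⟩
  · exact Set.ncard_le_ncard (fun p hp => ⟨hX.sub hp, hp.2⟩) (lattice_finite X)
  · intro i
    obtain ⟨s, hs, h⟩ := hedge i
    exact ⟨s, h, hs.2⟩
  · intro i
    have := X.npos
    have h1 := hsucc (i + (X.n - 1))
    rwa [show i + (X.n - 1) + 1 = i + X.n by omega, X.periodic] at h1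

lemma perim_int (P X : ClockPolygon) (D0 D1 : ℕ)
    (hlat : ∀ j, IsLatticePt ((D0 : ℝ) • P.verts j))
    (hv : ∀ i, IsLatticePt ((D1 : ℝ) • X.verts i)) :
    ((D1 * D0 : ℕ) : ℝ) * omegaPerim P.body X ∈ ZR := by
  unfold omegaPerim
  rw [Finset.mul_sum]
  refine ZR.sum_mem fun i _ => ?_
  obtain ⟨⟨j, hj⟩, -⟩ := omegaLen_spec P (X.verts (i + 1) - X.verts i)
  have : ((D1 * D0 : ℕ) : ℝ) * omegaLen P.body (X.verts (i + 1) - X.verts i) =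
      det2 ((D1 : ℝ) • X.verts (i + 1) - (D1 : ℝ) • X.verts i) ((D0 : ℝ) • P.verts j) := by
    rw [hj, ← smul_sub, det2_smul_left, det2_smul_right]; push_cast; ring
  rw [this]
  exact det2_ZR (lattice_sub (hv _) (hv _)) (hlat j)

lemma exists_seed (P : ClockPolygon) (hint : (interior P.body).Nonempty) (k D0 : ℕ)
    (hD0 : 0 < D0) (hlat : ∀ j, IsLatticePt ((D0 : ℝ) • P.verts j)) :
    ∃ Q : ClockPolygon, EdgesParallel Q P ∧ k + 1 ≤ latticeCount Q.body := by
  have hn : 2 ≤ P.n := by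
    by_contra hlt
    have := P.npos
    have h1 : P.n = 1 := by omega
    have hb : P.body = {P.verts 0} := by
      unfold ClockPolygon.body
      have : Set.range P.verts = {P.verts 0} := by
        ext z
        constructor
        · rintro ⟨i, rfl⟩
          rw [Set.mem_singleton_iff, P.verts_eq_iff, h1]; omega
        · rintro rfl; exact ⟨0, rfl⟩
      rw [this, convexHull_singleton]
    rw [hb, interior_singleton] at hint
    exact Set.not_nonempty_empty hint
  have hD0' : (D0 : ℝ) ≠ 0 := by exact_mod_cast hD0.ne'
  obtain ⟨E, hE⟩ : ∃ E, E = (D0 : ℝ) • (P.verts (0 + 1) - P.verts 0) := ⟨_, rfl⟩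
  have hE0 : E ≠ 0 := by
    rw [hE]
    exact smul_ne_zero hD0' (sub_ne_zero.2 (P.edge_ne hn 0))
  have hEl : IsLatticePt E := by
    rw [hE, smul_sub]; exact lattice_sub (hlat _) (hlat _)
  have hk : ((k + 1 : ℕ) : ℝ) ≠ 0 := by positivity
  obtain ⟨Q, m0, m1, -, hR⟩ := seg_poly 0 (((k + 1 : ℕ) : ℝ) • E)
    (Ne.symm (smul_ne_zero hk hE0))
  refine ⟨Q, (edgesParallel_iff Q P).2 (hR (fun p q => ParTo P (q - p)) ?_ ?_), ?_⟩
  · exact ⟨0, P.npos, ((k + 1 : ℕ) : ℝ) * D0, by rw [sub_zero, hE, smul_smul]⟩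
  · exact ⟨0, P.npos, -(((k + 1 : ℕ) : ℝ) * D0), by rw [zero_sub, hE, smul_smul, neg_smul]⟩
  · have hinj : Function.Injective (fun i : ℕ => (i : ℝ) • E) := by
      intro i j hij
      have := smul_left_injective ℝ hE0 hij
      exact_mod_cast this
    have hsub : (fun i : ℕ => (i : ℝ) • E) '' (Finset.range (k + 1) : Set ℕ) ⊆
        {p ∈ Q.body | IsLatticePt p} := by
      rintro _ ⟨i, hi, rfl⟩
      refine ⟨?_, lattice_smul i hEl⟩
      have hi' : i < k + 1 := by simpa using hi
      have hi2 : (i : ℝ) ≤ ((k + 1 : ℕ) : ℝ) := by exact_mod_cast hi'.le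
      have hkp : (0 : ℝ) < ((k + 1 : ℕ) : ℝ) := by positivity
      have e : (i : ℝ) • E = (1 - (i : ℝ) / ((k + 1 : ℕ) : ℝ)) • (0 : ℝ × ℝ) +
          ((i : ℝ) / ((k + 1 : ℕ) : ℝ)) • (((k + 1 : ℕ) : ℝ) • E) := by
        rw [smul_zero, zero_add, smul_smul, div_mul_cancel₀ _ hk]
      simp only
      rw [e]
      have h1 : (i : ℝ) / ((k + 1 : ℕ) : ℝ) ≤ 1 := (div_le_one hkp).2 hi2
      exact Q.body_convex m0 m1 (by linarith) (by positivity) (by ring)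
    have := Set.ncard_le_ncard hsub (lattice_finite Q)
    rw [Set.ncard_image_of_injective _ hinj, Set.ncard_coe_finset, Finset.card_range] at this
    exact this

/-- For a rational convex domain `Ω` and `k ∈ ℤ≥0`, the
infimum of `ℓ_Ω(∂Ξ)` over polygons `Ξ` with edges parallel to edges of `Ω`
and at least `k+1` lattice points is attained, and is attained by a polygon
having a lattice point on every edge — hence with all vertices rational. -/
theorem inf_parallel_attained (Ω : ConvexDomain) (hrat : Ω.IsRational) (k : ℕ) :
    ∃ Ξ : ClockPolygon, EdgesParallel Ξ Ω.P ∧ k + 1 ≤ latticeCount Ξ.body ∧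
      omegaPerim Ω.body Ξ =
        sInf { r | ∃ Q : ClockPolygon, EdgesParallel Q Ω.P ∧
          k + 1 ≤ latticeCount Q.body ∧ omegaPerim Ω.body Q = r } ∧
      (∀ i < Ξ.n, Ξ.verts (i + 1) - Ξ.verts i ≠ 0 →
        ∃ p ∈ segment ℝ (Ξ.verts i) (Ξ.verts (i + 1)), IsLatticePt p) ∧
      (∀ i, IsRationalPt (Ξ.verts i)) := by
  obtain ⟨D0, D1, hD0, hD1, hlat, hcr⟩ := exists_denoms Ω.P hrat
  obtain ⟨Q0, hQ0, hQ0'⟩ := exists_seed Ω.P Ω.int_nonempty k D0 hD0 hlat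
  have hgood := exists_good Ω.P Ω.zero_mem k D0 D1 hD0 hlat hcr
  have hL := sublin_omega Ω.P Ω.zero_mem
  have hMpos : (0 : ℝ) < ((D1 * D0 : ℕ) : ℝ) := by exact_mod_cast Nat.mul_pos hD1 hD0
  obtain ⟨Ξ, hΞ, hmin⟩ := exists_min_nat (Good Ω.P k D1)
    (fun X => ⌊((D1 * D0 : ℕ) : ℝ) * omegaPerim Ω.P.body X⌋₊)
    (by obtain ⟨X, hX, -⟩ := hgood Q0 hQ0 hQ0'; exact ⟨X, hX⟩)
  have hfl : ∀ X, Good Ω.P k D1 X →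
      ((⌊((D1 * D0 : ℕ) : ℝ) * omegaPerim Ω.P.body X⌋₊ : ℕ) : ℝ) =
        ((D1 * D0 : ℕ) : ℝ) * omegaPerim Ω.P.body X := by
    intro X hX
    obtain ⟨m, hm⟩ := mem_ZR.1 (perim_int Ω.P X D0 D1 hlat hX.vert)
    have hnn : 0 ≤ ((D1 * D0 : ℕ) : ℝ) * omegaPerim Ω.P.body X :=
      mul_nonneg hMpos.le (Finset.sum_nonneg fun i _ => hL.nonneg _)
    rw [hm] at hnn ⊢
    have hm0 : 0 ≤ m := by exact_mod_cast hnn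
    obtain ⟨n, rfl⟩ := Int.eq_ofNat_of_zero_le hm0
    simp
  refine ⟨Ξ, hΞ.par, hΞ.cnt, ?_, fun i _ _ => hΞ.edge i, ?_⟩
  · symm
    apply IsLeast.csInf_eq
    refine ⟨⟨Ξ, hΞ.par, hΞ.cnt, rfl⟩, ?_⟩
    rintro _ ⟨Q, hQ, hQ', rfl⟩
    obtain ⟨X, hX, hle⟩ := hgood Q hQ hQ'
    refine le_trans ?_ hle
    have h1 := hmin X hX
    have h2 : ((⌊((D1 * D0 : ℕ) : ℝ) * omegaPerim Ω.P.body Ξ⌋₊ : ℕ) : ℝ) ≤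
        ((⌊((D1 * D0 : ℕ) : ℝ) * omegaPerim Ω.P.body X⌋₊ : ℕ) : ℝ) := by exact_mod_cast h1
    rw [hfl Ξ hΞ, hfl X hX] at h2
    exact le_of_mul_le_mul_left h2 hMpos
  · intro i
    have hD1' : (D1 : ℝ) ≠ 0 := by exact_mod_cast hD1.ne'
    obtain ⟨⟨a, ha⟩, ⟨b, hb⟩⟩ := hΞ.vert i
    rw [Prod.smul_fst, smul_eq_mul] at ha
    rw [Prod.smul_snd, smul_eq_mul] at hb
    refine ⟨⟨(a : ℚ) / D1, ?_⟩, ⟨(b : ℚ) / D1, ?_⟩⟩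
    · push_cast
      rw [← ha]; field_simp
    · push_cast
      rw [← hb]; field_simp

end
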